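/- Let V′ be a faithful irreducible six-dimensional complex representation of the quasi-simple group 3.A7 and let V″ = (V′)∨ be its dual. Then the tensor product V′ ⊗ V″ decomposes as a direct sum of the trivial representation and two irreducible non-faithful representations (i.e. representations factoring through A7) of dimensions 14 and 21. If instead V″ is the non-faithful irreducible six-dimensional representation of 3.A7, then V′ ⊗ V″ decomposes as a direct sum of two faithful irreducible representations of dimensions 15 and 21. -/

import Mathlib

open scoped TensorProduct

/-- `G` is isomorphic to `3.A₇`: a quasi-simple (in particular perfect) group whose center is
cyclic of order `3` and whose quotient by the center is the alternating group `A₇`.  Such a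
group is unique up to isomorphism. -/
def IsTripleCoverA7 (G : Type*) [Group G] : Prop :=
  commutator G = ⊤ ∧ IsCyclic (Subgroup.center G) ∧ Nat.card (Subgroup.center G) = 3 ∧
    Nonempty (G ⧸ Subgroup.center G ≃* alternatingGroup (Fin 7))

section Subreps

variable {G : Type*} [Group G] {M : Type*} [AddCommGroup M] [Module ℂ M]

/-- A submodule is a subrepresentation if it is stable under the group action. -/
def IsSubrep (σ : Representation ℂ G M) (W : Submodule ℂ M) : Prop :=
  ∀ g : G, ∀ x ∈ W, σ g x ∈ W

/-- A subrepresentation is irreducible if it is nonzero and has no proper nonzero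
subrepresentation. -/
def IsIrredSubrep (σ : Representation ℂ G M) (W : Submodule ℂ M) : Prop :=
  IsSubrep σ W ∧ W ≠ ⊥ ∧
    ∀ W' : Submodule ℂ M, W' ≤ W → IsSubrep σ W' → W' = ⊥ ∨ W' = W

/-- The group acts trivially on the subrepresentation `W`. -/
def TrivialOn (σ : Representation ℂ G M) (W : Submodule ℂ M) : Prop :=
  ∀ g : G, ∀ x ∈ W, σ g x = x

/-- The group acts faithfully on the subrepresentation `W`. -/
def FaithfulOn (σ : Representation ℂ G M) (W : Submodule ℂ M) : Prop :=
  ∀ g : G, (∀ x ∈ W, σ g x = x) → g = 1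

end Subreps

section PartPA
/-! ### Traces of operators of finite order -/

lemma idem_trace {M : Type*} [AddCommGroup M] [Module ℂ M] [FiniteDimensional ℂ M]
    (P : Module.End ℂ M) (hP : P * P = P) : ∃ m : ℕ, LinearMap.trace ℂ M P = m := by
  have h : LinearMap.IsProj (LinearMap.range P) P := by
    refine ⟨fun x => ⟨x, rfl⟩, ?_⟩
    rintro x ⟨y, rfl⟩
    have := congrArg (fun f : Module.End ℂ M => f y) hP
    simpa using this
  exact ⟨_, h.trace⟩

lemma avg_mul {R : Type*} [Ring R] (B : R) (n : ℕ) (h : B ^ n = 1) :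
    B * (∑ k ∈ Finset.range n, B ^ k) = ∑ k ∈ Finset.range n, B ^ k := by
  have := mul_geom_sum B n
  rw [h, sub_self, sub_mul, one_mul, sub_eq_zero] at this
  exact this

lemma avg_pow_mul {R : Type*} [Ring R] (B : R) (n : ℕ) (h : B ^ n = 1) (j : ℕ) :
    B ^ j * (∑ k ∈ Finset.range n, B ^ k) = ∑ k ∈ Finset.range n, B ^ k := by
  induction j with
  | zero => simp
  | succ j ih => rw [pow_succ, mul_assoc, avg_mul B n h, ih]

lemma avg_sq {R : Type*} [Ring R] (B : R) (n : ℕ) (h : B ^ n = 1) :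
    (∑ k ∈ Finset.range n, B ^ k) * (∑ k ∈ Finset.range n, B ^ k)
      = (n : R) * ∑ k ∈ Finset.range n, B ^ k := by
  rw [Finset.sum_mul, Finset.sum_congr rfl (fun j _ => avg_pow_mul B n h j)]
  simp

lemma mult_nat {M : Type*} [AddCommGroup M] [Module ℂ M] [FiniteDimensional ℂ M]
    (A : Module.End ℂ M) (n : ℕ) (hn : n ≠ 0) (hA : A ^ n = 1) (ζ : ℂ) (hζ : ζ ^ n = 1) :
    ∃ m : ℕ, ∑ k ∈ Finset.range n, ζ ^ k * LinearMap.trace ℂ M (A ^ k) = n * m := by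
  set B : Module.End ℂ M := ζ • A with hB
  have hBn : B ^ n = 1 := by rw [hB, smul_pow, hζ, hA, one_smul]
  set S := ∑ k ∈ Finset.range n, B ^ k with hS
  have hSS : S * S = (n : Module.End ℂ M) * S := avg_sq B n hBn
  have hn' : (n : ℂ) ≠ 0 := by exact_mod_cast hn
  have hSS' : S * S = (n : ℂ) • S := by
    rw [hSS, ← nsmul_eq_mul, ← Nat.cast_smul_eq_nsmul ℂ]
  obtain ⟨m, hm⟩ := idem_trace ((n : ℂ)⁻¹ • S) (by
    rw [smul_mul_smul_comm, hSS', smul_smul]; congr 1; field_simp)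
  refine ⟨m, ?_⟩
  rw [← hm, map_smul, hS, map_sum, smul_eq_mul, mul_inv_cancel_left₀ hn']
  refine Finset.sum_congr rfl fun k _ => ?_
  rw [hB, smul_pow, map_smul, smul_eq_mul]

lemma mult_nat2 {M : Type*} [AddCommGroup M] [Module ℂ M] [FiniteDimensional ℂ M]
    (A B : Module.End ℂ M) (n : ℕ) (hn : n ≠ 0) (hA : A ^ n = 1) (hB : B ^ n = 1)
    (hAB : A * B = B * A) :
    ∃ m : ℕ, ∑ i ∈ Finset.range n, ∑ j ∈ Finset.range n,
      LinearMap.trace ℂ M (A ^ i * B ^ j) = n * n * m := by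
  set S := ∑ k ∈ Finset.range n, A ^ k with hS
  set T := ∑ k ∈ Finset.range n, B ^ k with hT
  have hn' : (n : ℂ) ≠ 0 := by exact_mod_cast hn
  have hSS : S * S = (n : ℂ) • S := by
    rw [avg_sq A n hA, ← nsmul_eq_mul, ← Nat.cast_smul_eq_nsmul ℂ]
  have hTT : T * T = (n : ℂ) • T := by
    rw [avg_sq B n hB, ← nsmul_eq_mul, ← Nat.cast_smul_eq_nsmul ℂ]
  have hc : Commute S T := by
    refine Commute.sum_left _ _ _ fun i _ => Commute.sum_right _ _ _ fun j _ => ?_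
    exact Commute.pow_pow hAB i j
  obtain ⟨m, hm⟩ := idem_trace (((n : ℂ) * n)⁻¹ • (S * T)) (by
    have : (S * T) * (S * T) = ((n : ℂ) * n) • (S * T) := by
      rw [hc.symm.mul_mul_mul_comm, hSS, hTT, smul_mul_smul_comm]
    rw [smul_mul_smul_comm, this, smul_smul]; congr 1; field_simp)
  refine ⟨m, ?_⟩
  rw [← hm, map_smul, smul_eq_mul, mul_inv_cancel_left₀ (mul_ne_zero hn' hn'), hS, hT,
    Finset.sum_mul_sum, map_sum]
  simp only [map_sum]

section Orders
variable {M : Type*} [AddCommGroup M] [Module ℂ M] [FiniteDimensional ℂ M]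

lemma tr_one : LinearMap.trace ℂ M (1 : Module.End ℂ M) = Module.finrank ℂ M :=
  LinearMap.trace_one ℂ M

lemma ord2 (A : Module.End ℂ M) (h : A ^ 2 = 1) :
    ∃ m : ℤ, LinearMap.trace ℂ M A = Module.finrank ℂ M - 2 * m := by
  obtain ⟨m, hm⟩ := mult_nat A 2 (by norm_num) h (-1) (by norm_num)
  refine ⟨m, ?_⟩
  simp only [Finset.sum_range_succ, Finset.range_zero, Finset.sum_empty, pow_zero, tr_one,
    pow_one] at hm
  push_cast at hm ⊢
  linear_combination -hm

lemma cube_root : ∃ w : ℂ, w ^ 3 = 1 ∧ 1 + w + w ^ 2 = 0 := by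
  have h := Complex.isPrimitiveRoot_exp 3 (by norm_num)
  refine ⟨_, h.pow_eq_one, ?_⟩
  have := h.geom_sum_eq_zero (by norm_num)
  simpa [Finset.sum_range_succ] using this

lemma ord3 (A : Module.End ℂ M) (h : A ^ 3 = 1)
    (h2 : LinearMap.trace ℂ M (A ^ 2) = LinearMap.trace ℂ M A) :
    ∃ m : ℤ, LinearMap.trace ℂ M A = Module.finrank ℂ M - 3 * m := by
  obtain ⟨w, hw, hw'⟩ := cube_root
  obtain ⟨m, hm⟩ := mult_nat A 3 (by norm_num) h w hw
  refine ⟨m, ?_⟩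
  simp only [Finset.sum_range_succ, Finset.range_zero, Finset.sum_empty, pow_zero, tr_one,
    pow_one, h2] at hm
  push_cast at hm ⊢
  linear_combination -hm + LinearMap.trace ℂ M A * hw'

lemma ord4 (A : Module.End ℂ M) (h : A ^ 4 = 1)
    (h3 : LinearMap.trace ℂ M (A ^ 3) = LinearMap.trace ℂ M A) :
    ∃ m n : ℤ, LinearMap.trace ℂ M (A ^ 2) = Module.finrank ℂ M - 4 * m ∧
      LinearMap.trace ℂ M A = 2 * n + 2 * m - Module.finrank ℂ M := by
  obtain ⟨m, hm⟩ := mult_nat A 4 (by norm_num) h Complex.I Complex.I_pow_four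
  obtain ⟨n, hn⟩ := mult_nat A 4 (by norm_num) h 1 (by norm_num)
  simp only [Finset.sum_range_succ, Finset.range_zero, Finset.sum_empty, pow_zero, tr_one,
    pow_one, h3] at hm hn
  push_cast at hm hn
  have hI : Complex.I ^ 3 = - Complex.I := by rw [pow_succ, Complex.I_sq]; ring
  rw [hI, Complex.I_sq] at hm
  refine ⟨m, n, ?_, ?_⟩
  · push_cast; linear_combination -hm
  · push_cast; linear_combination hn / 2 + hm / 2

lemma ord5 (A : Module.End ℂ M) (h : A ^ 5 = 1)
    (h2 : LinearMap.trace ℂ M (A ^ 2) = LinearMap.trace ℂ M A)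
    (h3 : LinearMap.trace ℂ M (A ^ 3) = LinearMap.trace ℂ M A)
    (h4 : LinearMap.trace ℂ M (A ^ 4) = LinearMap.trace ℂ M A) :
    ∃ m : ℤ, LinearMap.trace ℂ M A = Module.finrank ℂ M - 5 * m := by
  have hp := Complex.isPrimitiveRoot_exp 5 (by norm_num)
  set w := Complex.exp (2 * Real.pi * Complex.I / (5 : ℕ))
  have hw := hp.geom_sum_eq_zero (by norm_num)
  obtain ⟨m, hm⟩ := mult_nat A 5 (by norm_num) h w hp.pow_eq_one
  refine ⟨m, ?_⟩
  simp only [Finset.sum_range_succ, Finset.range_zero, Finset.sum_empty, pow_zero, tr_one,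
    pow_one, h2, h3, h4] at hm hw
  push_cast at hm ⊢
  linear_combination -hm + LinearMap.trace ℂ M A * hw

lemma ord6 (A : Module.End ℂ M) (h : A ^ 6 = 1)
    (h4 : LinearMap.trace ℂ M (A ^ 4) = LinearMap.trace ℂ M (A ^ 2))
    (h5 : LinearMap.trace ℂ M (A ^ 5) = LinearMap.trace ℂ M A) :
    ∃ m : ℤ, LinearMap.trace ℂ M A = Module.finrank ℂ M - LinearMap.trace ℂ M (A ^ 2)
      + LinearMap.trace ℂ M (A ^ 3) - 6 * m := by
  obtain ⟨w, hw, hw'⟩ := cube_root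
  obtain ⟨m, hm⟩ := mult_nat A 6 (by norm_num) h w
    (by rw [show 6 = 3 * 2 from rfl, pow_mul, hw, one_pow])
  refine ⟨m, ?_⟩
  have hw4 : w ^ 4 = w := by rw [pow_succ, hw, one_mul]
  have hw5 : w ^ 5 = w ^ 2 := by rw [pow_succ, hw4, sq]
  simp only [Finset.sum_range_succ, Finset.range_zero, Finset.sum_empty, pow_zero, tr_one,
    pow_one, h4, h5, hw, hw4, hw5] at hm
  push_cast at hm ⊢
  linear_combination -hm + (LinearMap.trace ℂ M A + LinearMap.trace ℂ M (A ^ 2)) * hw'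

lemma ord7 (A : Module.End ℂ M) (h : A ^ 7 = 1) (hd : Module.finrank ℂ M = 6)
    (h2 : LinearMap.trace ℂ M (A ^ 2) = LinearMap.trace ℂ M A)
    (h4 : LinearMap.trace ℂ M (A ^ 4) = LinearMap.trace ℂ M A)
    (h3 : LinearMap.trace ℂ M (A ^ 3) = LinearMap.trace ℂ M (A ^ 6))
    (h5 : LinearMap.trace ℂ M (A ^ 5) = LinearMap.trace ℂ M (A ^ 6)) :
    ∃ r : ℝ, 1 ≤ r ∧ LinearMap.trace ℂ M A * LinearMap.trace ℂ M (A ^ 6) = r := by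
  have hp := Complex.isPrimitiveRoot_exp 7 (by norm_num)
  set w := Complex.exp (2 * Real.pi * Complex.I / (7 : ℕ))
  have hw := hp.geom_sum_eq_zero (by norm_num)
  have hw7 : w ^ 7 = 1 := hp.pow_eq_one
  obtain ⟨m, hm⟩ := mult_nat A 7 (by norm_num) h w hw7
  obtain ⟨n, hn⟩ := mult_nat A 7 (by norm_num) h (w ^ 6)
    (by rw [← pow_mul, mul_comm, pow_mul, hw7, one_pow])
  set x := LinearMap.trace ℂ M A
  set y := LinearMap.trace ℂ M (A ^ 6)
  simp only [Finset.sum_range_succ, Finset.range_zero, Finset.sum_empty, pow_zero, tr_one,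
    pow_one, h2, h3, h4, h5, hd] at hm hn hw
  push_cast at hm hn
  have e2 : (w ^ 6) ^ 2 = w ^ 5 := by linear_combination w ^ 5 * hw7
  have e3 : (w ^ 6) ^ 3 = w ^ 4 := by linear_combination (w ^ 11 + w ^ 4) * hw7
  have e4 : (w ^ 6) ^ 4 = w ^ 3 := by linear_combination (w ^ 17 + w ^ 10 + w ^ 3) * hw7
  have e5 : (w ^ 6) ^ 5 = w ^ 2 := by
    linear_combination (w ^ 23 + w ^ 16 + w ^ 9 + w ^ 2) * hw7
  have e6 : (w ^ 6) ^ 6 = w := by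
    linear_combination (w ^ 29 + w ^ 22 + w ^ 15 + w ^ 8 + w) * hw7
  rw [e2, e3, e4, e5, e6] at hn
  have hs : x + y = 12 - 7 * (m + n) := by
    linear_combination -hm - hn + (x + y) * hw
  have hdlt : (x - y) * (w + w ^ 2 + w ^ 4 - w ^ 3 - w ^ 5 - w ^ 6) = 7 * (m - n) := by
    linear_combination hm - hn
  have hd2 : (w + w ^ 2 + w ^ 4 - w ^ 3 - w ^ 5 - w ^ 6) ^ 2 = -7 := by
    have hb : (w + w ^ 2 + w ^ 4) ^ 2 + (w + w ^ 2 + w ^ 4) + 2 = 0 := by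
      linear_combination w * hw7 + 2 * hw
    have hd' : w + w ^ 2 + w ^ 4 - w ^ 3 - w ^ 5 - w ^ 6 = 2 * (w + w ^ 2 + w ^ 4) + 1 := by
      linear_combination -hw
    rw [hd']
    linear_combination 4 * hb
  have hxy : (x - y) ^ 2 = -7 * (m - n) ^ 2 := by
    have : (x - y) ^ 2 * (-7) = 49 * (m - n) ^ 2 := by
      rw [← hd2, ← mul_pow, hdlt]; ring
    linear_combination -this / 7
  refine ⟨((12 - 7 * (m + n)) ^ 2 + 7 * (m - n) ^ 2) / 4, ?_, ?_⟩
  · have h1 : (4 : ℤ) ≤ (12 - 7 * (m + n)) ^ 2 := by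
      have : (12 - 7 * ((m : ℤ) + n)) ≤ -2 ∨ 2 ≤ (12 - 7 * ((m : ℤ) + n)) := by omega
      rcases this with h | h <;> nlinarith
    have h1' : (4 : ℝ) ≤ (12 - 7 * (m + n)) ^ 2 := by exact_mod_cast h1
    have := sq_nonneg ((m : ℝ) - n)
    linarith
  · push_cast
    linear_combination (x + y + 12 - 7 * (m + n)) * hs / 4 - hxy / 4

end Orders

end PartPA

section PartPR
/-! ### Generic representation theory -/

section Generic
variable {G : Type} [Group G] {M : Type} [AddCommGroup M] [Module ℂ M]

/-- irreducibility in the elementary form -/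
def Irr (σ : Representation ℂ G M) : Prop :=
  ∀ W : Submodule ℂ M, IsSubrep σ W → W = ⊥ ∨ W = ⊤

/-- restriction to a subrepresentation -/
def restr (σ : Representation ℂ G M) (W : Submodule ℂ M) (h : IsSubrep σ W) :
    Representation ℂ G W :=
  (⟨W, fun g x hx => h g x hx⟩ : Subrepresentation σ).toRepresentation

lemma restr_apply (σ : Representation ℂ G M) (W : Submodule ℂ M) (h : IsSubrep σ W) (g : G)
    (x : W) : ((restr σ W h g x : W) : M) = σ g x := rfl

lemma irr_isIrreducible [Nontrivial M] (σ : Representation ℂ G M) (h : Irr σ) :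
    σ.IsIrreducible := by
  have : Nontrivial (Subrepresentation σ) := by
    refine ⟨⊥, ⊤, fun h => ?_⟩
    have h2 : (⊥ : Submodule ℂ M) = ⊤ := congrArg Subrepresentation.toSubmodule h
    exact bot_ne_top h2
  refine ⟨fun W => ?_⟩
  rcases h W.toSubmodule (fun g x hx => W.apply_mem_toSubmodule g hx) with h | h
  · left; exact Subrepresentation.toSubmodule_injective h
  · right; exact Subrepresentation.toSubmodule_injective h

lemma exists_compl_subrep [Finite G] (σ : Representation ℂ G M) (W : Submodule ℂ M)
    (h : IsSubrep σ W) : ∃ W', IsSubrep σ W' ∧ IsCompl W W' := by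
  have : NeZero (Nat.card G : ℂ) := ⟨by exact_mod_cast Nat.card_pos.ne'⟩
  have hs : σ.IsSemisimpleRepresentation := inferInstance
  obtain ⟨W', hW'⟩ := hs.exists_isCompl (⟨W, fun g x hx => h g x hx⟩ : Subrepresentation σ)
  refine ⟨W'.toSubmodule, fun g x hx => W'.apply_mem_toSubmodule g hx, ?_⟩
  constructor
  · have := hW'.inf_eq_bot
    rw [disjoint_iff]
    exact congrArg Subrepresentation.toSubmodule this
  · have := hW'.sup_eq_top
    rw [codisjoint_iff]
    exact congrArg Subrepresentation.toSubmodule this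

lemma char_add [FiniteDimensional ℂ M] (σ : Representation ℂ G M) (W W' : Submodule ℂ M)
    (h : IsSubrep σ W) (h' : IsSubrep σ W') (hc : IsCompl W W') (g : G) :
    σ.character g = (restr σ W h).character g + (restr σ W' h').character g := by
  have e := Submodule.prodEquivOfIsCompl W W' hc
  have key : σ g = (Submodule.prodEquivOfIsCompl W W' hc).conj
      (LinearMap.prodMap (restr σ W h g) (restr σ W' h' g)) := by
    ext x
    obtain ⟨⟨a, b⟩, rfl⟩ := (Submodule.prodEquivOfIsCompl W W' hc).surjective x
    simp [LinearEquiv.conj_apply, Submodule.coe_prodEquivOfIsCompl', restr_apply]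
  unfold Representation.character
  rw [key, LinearMap.trace_conj', LinearMap.trace_prodMap']

lemma cross_nat [Fintype G] [FiniteDimensional ℂ M] {N : Type} [AddCommGroup N] [Module ℂ N]
    [FiniteDimensional ℂ N] (σ : Representation ℂ G M) (τ : Representation ℂ G N) :
    ∑ g, σ.character g * τ.character g⁻¹ =
      Nat.card G * Module.finrank ℂ (Representation.IntertwiningMap τ σ) := by
  have h0 : (Nat.card G : ℂ) ≠ 0 := by exact_mod_cast Nat.card_pos.ne'
  let : Invertible (Nat.card G : ℂ) := invertibleOfNonzero h0
  have := Representation.card_inv_mul_sum_char_mul_char_eq_finrank (ρ := τ) (σ := σ)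
  rw [← this]

  rw [mul_inv_cancel_left₀ h0]

lemma nrm_pos [Fintype G] [FiniteDimensional ℂ M] [Nontrivial M] (σ : Representation ℂ G M) :
    0 < Module.finrank ℂ (Representation.IntertwiningMap σ σ) := by
  rw [← (Representation.invariantsEquivIntertwiningMap σ σ).finrank_eq]
  have : Nontrivial (Representation.linHom σ σ).invariants := by
    refine ⟨⟨⟨1, fun g => ?_⟩, 0, fun h => ?_⟩⟩
    · ext x
      simp [Representation.linHom_apply]
    · have h2 : (1 : M →ₗ[ℂ] M) = 0 := congrArg Subtype.val h
      exact one_ne_zero h2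
  exact Module.finrank_pos

/-- splitting inequality -/
lemma nrm_split [Fintype G] [FiniteDimensional ℂ M] (σ : Representation ℂ G M)
    (W W' : Submodule ℂ M) (h : IsSubrep σ W) (h' : IsSubrep σ W') (hc : IsCompl W W') :
    Module.finrank ℂ (Representation.IntertwiningMap (restr σ W h) (restr σ W h)) +
    Module.finrank ℂ (Representation.IntertwiningMap (restr σ W' h') (restr σ W' h')) ≤
    Module.finrank ℂ (Representation.IntertwiningMap σ σ) := by
  have h0 : (Nat.card G : ℂ) ≠ 0 := by exact_mod_cast Nat.card_pos.ne'
  have e := cross_nat σ σ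
  simp only [char_add σ W W' h h' hc, add_mul, mul_add, Finset.sum_add_distrib, cross_nat] at e
  simp only [← mul_add] at e
  have e2 := mul_left_cancel₀ h0 e
  norm_cast at e2
  omega

lemma irr_of_nrm_one [Fintype G] [FiniteDimensional ℂ M] (σ : Representation ℂ G M)
    (h1 : Module.finrank ℂ (Representation.IntertwiningMap σ σ) ≤ 1) : Irr σ := by
  intro W hW
  by_contra hcon
  push Not at hcon
  obtain ⟨W', hW', hc⟩ := exists_compl_subrep σ W hW
  have := nrm_split σ W W' hW hW' hc
  have n1 : Nontrivial W := Submodule.nontrivial_iff_ne_bot.2 hcon.1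
  have n2 : Nontrivial W' := by
    refine Submodule.nontrivial_iff_ne_bot.2 fun hb => hcon.2 ?_
    have := hc.sup_eq_top
    rwa [hb, sup_bot_eq] at this
  have p1 := nrm_pos (restr σ W hW)
  have p2 := nrm_pos (restr σ W' hW')
  omega

lemma nrm_of_irr [Fintype G] [FiniteDimensional ℂ M] [Nontrivial M] (σ : Representation ℂ G M)
    (h1 : Irr σ) : ∑ g, σ.character g * σ.character g⁻¹ = Nat.card G := by
  have := irr_isIrreducible σ h1
  rw [cross_nat]
  simp

/-- norm two implies a sum of two irreducibles -/
lemma two_irr [Fintype G] [FiniteDimensional ℂ M] (σ : Representation ℂ G M)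
    (h2 : ∑ g, σ.character g * σ.character g⁻¹ = Nat.card G * 2) :
    ∃ (W W' : Submodule ℂ M) (h : IsSubrep σ W) (h' : IsSubrep σ W'), IsCompl W W' ∧
      W ≠ ⊥ ∧ W' ≠ ⊥ ∧ Irr (restr σ W h) ∧ Irr (restr σ W' h') := by
  have h0 : (Nat.card G : ℂ) ≠ 0 := by exact_mod_cast Nat.card_pos.ne'
  have hn : Module.finrank ℂ (Representation.IntertwiningMap σ σ) = 2 := by
    rw [cross_nat] at h2
    have := mul_left_cancel₀ h0 h2
    exact_mod_cast this
  have hnt : Nontrivial M := by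
    by_contra hs
    rw [not_nontrivial_iff_subsingleton] at hs
    have : ∀ g, σ.character g = 0 := fun g => by
      unfold Representation.character
      rw [Subsingleton.elim (σ g) 0, map_zero]
    simp [this] at h2
  have hni : ¬ Irr σ := fun hi => by
    have := nrm_of_irr σ hi
    rw [h2] at this
    have := mul_left_cancel₀ h0 (this.trans (mul_one _).symm)
    norm_num at this
  unfold Irr at hni
  push Not at hni
  obtain ⟨W, hW, hb, ht⟩ := hni
  obtain ⟨W', hW', hc⟩ := exists_compl_subrep σ W hW
  have := nrm_split σ W W' hW hW' hc
  have hb' : W' ≠ ⊥ := fun hb => ht (by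
    have := hc.sup_eq_top
    rwa [hb, sup_bot_eq] at this)
  have n1 : Nontrivial W := Submodule.nontrivial_iff_ne_bot.2 hb
  have n2 : Nontrivial W' := Submodule.nontrivial_iff_ne_bot.2 hb'
  have p1 := nrm_pos (restr σ W hW)
  have p2 := nrm_pos (restr σ W' hW')
  exact ⟨W, W', hW, hW', hc, hb, hb', irr_of_nrm_one _ (by omega), irr_of_nrm_one _ (by omega)⟩

/-- transport of irreducibility along an injective equivariant map -/
lemma irred_map {N : Type} [AddCommGroup N] [Module ℂ N] (σ : Representation ℂ G M)
    (η : Representation ℂ G N) (hη : Irr η) [Nontrivial N] (φ : N →ₗ[ℂ] M)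
    (hφ : Function.Injective φ) (heq : ∀ g x, φ (η g x) = σ g (φ x)) :
    IsIrredSubrep σ (LinearMap.range φ) ∧
      Module.finrank ℂ (LinearMap.range φ) = Module.finrank ℂ N := by
  refine ⟨⟨?_, ?_, ?_⟩, LinearMap.finrank_range_of_inj hφ⟩
  · rintro g _ ⟨x, rfl⟩
    exact ⟨η g x, heq g x⟩
  · intro hb
    obtain ⟨x, hx⟩ := exists_ne (0 : N)
    have : φ x ∈ LinearMap.range φ := ⟨x, rfl⟩
    rw [hb, Submodule.mem_bot] at this
    exact hx (hφ (this.trans (map_zero φ).symm))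
  · intro W' hle hW'
    have : IsSubrep η (W'.comap φ) := by
      intro g x hx
      rw [Submodule.mem_comap, heq]
      exact hW' g _ hx
    have hm : (W'.comap φ).map φ = W' := by
      rw [Submodule.map_comap_eq, inf_eq_right.2 hle]
    rcases hη _ this with h | h
    · left; rw [← hm, h, Submodule.map_bot]
    · right; rw [← hm, h, Submodule.map_top]

/-- Schur's lemma -/
lemma schur [FiniteDimensional ℂ M] [Nontrivial M] (σ : Representation ℂ G M) (hσ : Irr σ)
    (T : Module.End ℂ M) (hT : ∀ g, σ g * T = T * σ g) : ∃ c : ℂ, T = c • 1 := by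
  obtain ⟨c, hc⟩ := Module.End.exists_eigenvalue T
  refine ⟨c, ?_⟩
  have hsub : IsSubrep σ (Module.End.eigenspace T c) := by
    intro g x hx
    rw [Module.End.mem_eigenspace_iff] at hx ⊢
    have := congrArg (fun f : Module.End ℂ M => f x) (hT g)
    simp only [Module.End.mul_apply] at this
    rw [← this, hx, map_smul]
  rcases hσ _ hsub with h | h
  · exact absurd h hc
  · ext x
    have : x ∈ Module.End.eigenspace T c := h ▸ Submodule.mem_top
    rw [Module.End.mem_eigenspace_iff] at this
    simpa using this

lemma class_sum [FiniteDimensional ℂ M] [Nontrivial M] (σ : Representation ℂ G M) (hσ : Irr σ)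
    (K : Finset G) (hK : ∀ g k, k ∈ K → g * k * g⁻¹ ∈ K) :
    (∑ k ∈ K, ∑ l ∈ K, σ.character (k * l)) * Module.finrank ℂ M =
      (∑ k ∈ K, σ.character k) ^ 2 := by
  obtain ⟨c, hc⟩ := schur σ hσ (∑ k ∈ K, σ k) (by
    intro g
    rw [Finset.mul_sum, Finset.sum_mul]
    refine Finset.sum_bij (fun k _ => g * k * g⁻¹) (fun k hk => hK g k hk) ?_ ?_ ?_
    · intro a _ b _ h; simpa using h
    · intro b hb
      exact ⟨g⁻¹ * b * g, by simpa using hK g⁻¹ b hb, by group⟩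
    · intro a _
      rw [← map_mul, ← map_mul]; congr 1; group)
  have t1 : ∑ k ∈ K, σ.character k = c * Module.finrank ℂ M := by
    have := congrArg (LinearMap.trace ℂ M) hc
    rw [map_sum, map_smul, tr_one] at this
    exact this
  have t2 : ∑ k ∈ K, ∑ l ∈ K, σ.character (k * l) = c * c * Module.finrank ℂ M := by
    have h2 : (∑ k ∈ K, σ k) * (∑ k ∈ K, σ k) = (c * c) • 1 := by
      rw [hc, smul_mul_smul_comm, one_mul]
    rw [Finset.sum_mul_sum] at h2
    have := congrArg (LinearMap.trace ℂ M) h2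
    rw [map_smul, tr_one] at this
    simp only [map_sum] at this
    rw [smul_eq_mul] at this
    rw [← this]
    simp only [Representation.character, map_mul]
  rw [t1, t2]; ring

end Generic

end PartPR

section PartPG
open scoped commutatorElement

/-! ### The triple cover -/

/-- The covering data. -/
structure Cov (G : Type) [Group G] where
  p : G →* alternatingGroup (Fin 7)
  surj : Function.Surjective p
  ker : p.ker = Subgroup.center G
  perf : commutator G = ⊤
  cz : Nat.card (Subgroup.center G) = 3

lemma cov_of (G : Type) [Group G] (hG : IsTripleCoverA7 G) : Nonempty (Cov G) := by
  obtain ⟨h1, -, h3, ⟨e⟩⟩ := hG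
  refine ⟨⟨e.toMonoidHom.comp (QuotientGroup.mk' _), ?_, ?_, h1, h3⟩⟩
  · exact e.surjective.comp (QuotientGroup.mk'_surjective _)
  · ext x
    simp

lemma card_A7 : Nat.card (alternatingGroup (Fin 7)) = 2520 := by
  rw [nat_card_alternatingGroup]
  simp [Nat.factorial]

section Cover
variable {G : Type} [Group G]

lemma Cov.mem (C : Cov G) {x : G} : C.p x = 1 ↔ x ∈ Subgroup.center G := by
  rw [← C.ker, MonoidHom.mem_ker]

lemma Cov.cube (C : Cov G) {z : G} (hz : z ∈ Subgroup.center G) : z ^ 3 = 1 := by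
  have : (⟨z, hz⟩ : Subgroup.center G) ^ 3 = 1 := by rw [← C.cz]; exact pow_card_eq_one'
  exact congrArg Subtype.val this

lemma Cov.diff (C : Cov G) {x y : G} (h : C.p x = C.p y) : ∃ z ∈ Subgroup.center G, y = x * z :=
  ⟨x⁻¹ * y, C.mem.1 (by rw [map_mul, map_inv, h, inv_mul_cancel]), by group⟩

lemma Cov.exists_z (C : Cov G) : ∃ z ∈ Subgroup.center G, z ≠ 1 := by
  have : Finite (Subgroup.center G) := Nat.finite_of_card_ne_zero (by rw [C.cz]; norm_num)
  have : Nontrivial (Subgroup.center G) := Finite.one_lt_card_iff_nontrivial.1 (by rw [C.cz]; norm_num)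
  obtain ⟨z, hz⟩ := exists_ne (1 : Subgroup.center G)
  exact ⟨z, z.2, fun h => hz (Subtype.ext h)⟩

lemma Cov.card (C : Cov G) : Nat.card G = 7560 := by
  have h1 := Subgroup.card_mul_index C.p.ker
  rw [Subgroup.index_ker, MonoidHom.range_eq_top.2 C.surj, Subgroup.card_top, card_A7, C.ker,
    C.cz] at h1
  omega

lemma Cov.normal (C : Cov G) (N : Subgroup G) [hN : N.Normal] : N ≤ Subgroup.center G ∨ N = ⊤ := by
  have hs : IsSimpleGroup (alternatingGroup (Fin 7)) :=
    alternatingGroup.isSimpleGroup (by simp)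
  rcases (hN.map C.p C.surj).eq_bot_or_eq_top with h | h
  · left
    rw [← C.ker]
    exact (Subgroup.map_eq_bot_iff N).1 h
  · right
    rw [eq_top_iff, ← C.perf, commutator_def, Subgroup.commutator_le]
    have dec : ∀ g : G, ∃ n ∈ N, ∃ z ∈ Subgroup.center G, g = n * z := by
      intro g
      have : C.p g ∈ N.map C.p := h ▸ Subgroup.mem_top _
      obtain ⟨n, hn, e⟩ := this
      obtain ⟨z, hz, e⟩ := C.diff e
      exact ⟨n, hn, z, hz, e⟩
    intro a _ b _
    obtain ⟨n, hn, z, hz, rfl⟩ := dec a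
    obtain ⟨m, hm, w, hw, rfl⟩ := dec b
    rw [Subgroup.mem_center_iff] at hz hw
    have : ⁅n * z, m * w⁆ = ⁅n, m⁆ := by
      simp only [commutatorElement_def, mul_inv_rev]
      calc n * z * (m * w) * (z⁻¹ * n⁻¹) * (w⁻¹ * m⁻¹)
          = n * (z * (m * w)) * z⁻¹ * n⁻¹ * (w⁻¹ * m⁻¹) := by group
        _ = n * m * (w * n⁻¹) * w⁻¹ * m⁻¹ := by rw [← hz]; group
        _ = _ := by rw [← hw]; group
    rw [this, commutatorElement_def]
    exact N.mul_mem (N.mul_mem (N.mul_mem hn hm) (N.inv_mem hn)) (N.inv_mem hm)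

lemma Cov.noncomm (C : Cov G) [Finite G] (x y : G) (hx : C.p x ^ 3 = 1) (hy : C.p y ^ 3 = 1)
    (hx1 : C.p x ≠ 1) (hy1 : C.p y ≠ 1) (hxy : C.p y ≠ C.p x) (hxy2 : C.p y ≠ C.p x ^ 2) :
    x * y ≠ y * x := by
  intro hc
  set S : Set G := (Subgroup.center G : Set G) ∪ {x, y} with hS
  set H := Subgroup.closure S with hH
  have hcomm : ∀ a ∈ S, ∀ b ∈ S, a * b = b * a := by
    rintro a (ha | ha) b hb
    · exact ((Subgroup.mem_center_iff.1 ha) b).symm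
    · rcases hb with hb | hb
      · exact (Subgroup.mem_center_iff.1 hb) a
      · rcases ha with rfl | rfl <;> rcases hb with rfl | rfl <;> first | rfl | exact hc | exact hc.symm
  have hmc : IsMulCommutative H := Subgroup.isMulCommutative_closure hcomm
  let _ : CommGroup H := { (inferInstance : Group H) with mul_comm := hmc.is_comm.comm }
  have hZH : Subgroup.center G ≤ H := fun z hz => Subgroup.subset_closure (Or.inl hz)
  have hxH : x ∈ H := Subgroup.subset_closure (Or.inr (by simp))
  have hyH : y ∈ H := Subgroup.subset_closure (Or.inr (by simp))
  -- nine divides the order of the image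
  have h9 : 9 ∣ Nat.card (H.map C.p) := by
    set A := Subgroup.zpowers (C.p x)
    set B := Subgroup.zpowers (C.p y)
    have oA : orderOf (C.p x) = 3 := orderOf_eq_prime hx hx1
    have oB : orderOf (C.p y) = 3 := orderOf_eq_prime hy hy1
    have hcp : Commute (C.p x) (C.p y) := by
      change _ * _ = _ * _
      rw [← map_mul, hc, map_mul]
    have hd : Disjoint A B := by
      rw [disjoint_iff_inf_le]
      intro w hw
      obtain ⟨hwA, hwB⟩ := Subgroup.mem_inf.1 hw
      by_contra hw1
      rw [Subgroup.mem_bot] at hw1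
      have hBw : Subgroup.zpowers w = B := by
        apply Subgroup.eq_of_le_of_card_ge
        · exact Subgroup.zpowers_le.2 hwB
        · rw [Nat.card_zpowers, Nat.card_zpowers, oB]
          have : orderOf w = 3 := by
            apply orderOf_eq_prime _ hw1
            obtain ⟨k, rfl⟩ := hwB
            change ((C.p y) ^ k) ^ 3 = 1
            rw [← zpow_natCast, zpow_comm, zpow_natCast, hy, one_zpow]
          omega
      have : C.p y ∈ A := by
        have h1 : C.p y ∈ B := Subgroup.mem_zpowers _
        rw [← hBw] at h1
        exact Subgroup.zpowers_le.2 hwA h1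
      have hf : ∃ k < 3, C.p x ^ k = C.p y := by
        have := (mem_powers_iff_mem_zpowers (x := C.p x) (y := C.p y)).2 this
        obtain ⟨k, hk⟩ := this
        refine ⟨k % 3, Nat.mod_lt _ (by norm_num), ?_⟩
        rw [← oA, pow_mod_orderOf]
        exact hk
      obtain ⟨k, hk, e⟩ := hf
      interval_cases k
      · exact hy1 (by simpa using e.symm)
      · exact hxy (by simpa using e.symm)
      · exact hxy2 e.symm
    let f := MonoidHom.noncommCoprod A.subtype B.subtype (by
      rintro ⟨a, k, rfl⟩ ⟨b, l, rfl⟩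
      exact hcp.zpow_zpow k l)
    have hf : Function.Injective f := by
      apply (MonoidHom.noncommCoprod_injective _ _ _).2
      exact ⟨Subtype.val_injective, Subtype.val_injective, by simpa using hd⟩
    have hcr : Nat.card f.range = 9 := by
      rw [← Nat.card_congr (MonoidHom.ofInjective hf).toEquiv, Nat.card_prod, Nat.card_zpowers,
        Nat.card_zpowers, oA, oB]
    have hle : f.range ≤ H.map C.p := by
      rintro _ ⟨⟨⟨a, k, rfl⟩, ⟨b, l, rfl⟩⟩, rfl⟩
      refine ⟨x ^ k * y ^ l, H.mul_mem (H.zpow_mem hxH k) (H.zpow_mem hyH l), ?_⟩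
      simp [f, map_mul, map_zpow]
    rw [← hcr]
    exact Subgroup.card_dvd_of_le hle
  have hidx : ¬ 3 ∣ H.index := by
    have h1 : (H.map C.p).index = H.index := by
      rw [Subgroup.index_map, C.ker, sup_eq_left.2 hZH, MonoidHom.range_eq_top.2 C.surj]
      simp
    have h2 := Subgroup.card_mul_index (H.map C.p)
    rw [card_A7, h1] at h2
    intro h3
    have : 27 ∣ 2520 := by
      rw [← h2]
      exact mul_dvd_mul h9 h3
    norm_num at this
  obtain ⟨z, hz, hz1⟩ := C.exists_z
  have ht : MonoidHom.transfer (MonoidHom.id H) = 1 := by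
    have := Abelianization.commutator_subset_ker (MonoidHom.transfer (MonoidHom.id H))
    rw [C.perf, top_le_iff] at this
    exact MonoidHom.ker_eq_top_iff.1 this
  have key := MonoidHom.transfer_eq_pow (MonoidHom.id H) z (by
    intro k g0 _
    have := Subgroup.mem_center_iff.1 (Subgroup.pow_mem _ hz k) g0
    rw [mul_assoc, ← this, inv_mul_cancel_left])
  rw [ht] at key
  have hzi : z ^ H.index = 1 := by
    have := congrArg Subtype.val key
    simpa using this.symm
  have hz3 := C.cube hz
  have ho : orderOf z = 3 := orderOf_eq_prime hz3 hz1
  exact hidx (ho ▸ orderOf_dvd_of_pow_eq_one hzi)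

end Cover

end PartPG

section PartPC
open Equiv Equiv.Perm

/-! ### Permutations of seven points -/

/-- representatives of the even classes -/
def rp : Fin 8 → Perm (Fin 7) := ![1,
  (swap 0 1 * swap 1 2 * swap 2 3 * swap 4 5) ^ 2,
  swap 0 1 * swap 1 2,
  swap 0 1 * swap 1 2 * (swap 3 4 * swap 4 5),
  swap 0 1 * swap 1 2 * swap 2 3 * swap 4 5,
  swap 0 1 * swap 1 2 * swap 2 3 * swap 3 4,
  swap 0 1 * swap 1 2 * swap 3 4 * swap 5 6,
  swap 0 1 * swap 1 2 * swap 2 3 * swap 3 4 * swap 4 5 * swap 5 6]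

/-- their cycle types -/
def ct : Fin 8 → Multiset ℕ := ![0, {2, 2}, {3}, {3, 3}, {4, 2}, {5}, {3, 2, 2}, {7}]

/-- class sizes -/
def cn : Fin 8 → ℕ := ![1, 105, 70, 280, 630, 504, 210, 720]

/-- computable class function -/
def clf (a b : ℕ) : Fin 8 :=
  if a = 0 then 0 else if a = 4 then 1 else if a = 3 then 2 else
  if a = 5 then 5 else if a = 6 then (if b = 0 then 3 else 4) else
  if b = 4 then 6 else 7

/-- computable class function -/
def cl (σ : Perm (Fin 7)) : Fin 8 := clf σ.support.card (σ ^ 3).support.card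

lemma cl_conj (π σ : Perm (Fin 7)) : cl (π * σ * π⁻¹) = cl σ := by
  unfold cl
  rw [conj_pow, card_support_conj, card_support_conj]

lemma cl_rp : ∀ i, cl (rp i) = i := by decide +kernel

lemma ct_rp : ∀ i, (rp i).cycleType = ct i := by decide +kernel

lemma sign_rp : ∀ i, sign (rp i) = 1 := by decide +kernel

/-- representatives in the alternating group -/
def ra (i : Fin 8) : alternatingGroup (Fin 7) := ⟨rp i, mem_alternatingGroup.2 (sign_rp i)⟩

lemma ct_inj : Function.Injective ct := by decide +kernel

lemma card_ct (i : Fin 8) :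
    (Finset.univ.filter fun g : alternatingGroup (Fin 7) =>
      (g : Perm (Fin 7)).cycleType = ct i).card = cn i := by
  rw [AlternatingGroup.card_of_cycleType]
  fin_cases i <;> decide +kernel

lemma ct_cover (g : alternatingGroup (Fin 7)) : ∃ i, (g : Perm (Fin 7)).cycleType = ct i := by
  have h : (Finset.univ.biUnion fun i : Fin 8 =>
      Finset.univ.filter fun g : alternatingGroup (Fin 7) =>
      (g : Perm (Fin 7)).cycleType = ct i) = Finset.univ := by
    apply Finset.eq_univ_of_card
    rw [Finset.card_biUnion]
    · simp only [card_ct]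
      rw [← Nat.card_eq_fintype_card, card_A7]
      decide
    · intro i _ j _ hij
      change _root_.Disjoint (Finset.filter _ _) (Finset.filter _ _)
      rw [Finset.disjoint_filter]
      intro x _ h1 h2
      exact hij (ct_inj (h1.symm.trans h2))
  have := Finset.mem_univ g
  rw [← h, Finset.mem_biUnion] at this
  obtain ⟨i, -, hi⟩ := this
  exact ⟨i, (Finset.mem_filter.1 hi).2⟩

lemma cl_ct {σ : Perm (Fin 7)} {i : Fin 8} (h : σ.cycleType = ct i) : cl σ = i := by
  rw [← ct_rp i, ← isConj_iff_cycleType_eq] at h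
  obtain ⟨π, hπ⟩ := isConj_iff.1 h
  rw [← cl_conj π, hπ, cl_rp]

/-- class of an even permutation -/
def ca (g : alternatingGroup (Fin 7)) : Fin 8 := cl g

lemma ca_iff (g : alternatingGroup (Fin 7)) (i : Fin 8) :
    ca g = i ↔ (g : Perm (Fin 7)).cycleType = ct i := by
  obtain ⟨j, hj⟩ := ct_cover g
  have := cl_ct hj
  unfold ca
  rw [this, hj]
  exact ct_inj.eq_iff.symm

lemma card_ca (i : Fin 8) : (Finset.univ.filter fun g => ca g = i).card = cn i := by
  simp only [ca_iff, card_ct]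

/-- every element is conjugate (in the symmetric group) to a representative -/
lemma ca_conj (g : alternatingGroup (Fin 7)) :
    ∃ π : Perm (Fin 7), g = MulAut.conjNormal π (ra (ca g)) := by
  have h := (ca_iff g _).1 rfl
  rw [← ct_rp, ← isConj_iff_cycleType_eq] at h
  obtain ⟨π, hπ⟩ := isConj_iff.1 h
  refine ⟨π⁻¹, Subtype.ext ?_⟩
  rw [MulAut.conjNormal_apply]
  change _ = π⁻¹ * rp (ca g) * π⁻¹⁻¹
  rw [← hπ]; group

lemma ca_conjNormal (π : Perm (Fin 7)) (g : alternatingGroup (Fin 7)) :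
    ca (MulAut.conjNormal π g) = ca g := by
  unfold ca
  rw [MulAut.conjNormal_apply, cl_conj]

lemma ca_mulconj (h g : alternatingGroup (Fin 7)) : ca (h * g * h⁻¹) = ca g := by
  unfold ca
  exact cl_conj _ _

lemma ca_inv (g : alternatingGroup (Fin 7)) : ca g⁻¹ = ca g := by
  unfold ca cl
  simp

lemma ca_ra (i : Fin 8) : ca (ra i) = i := cl_rp i

lemma ca_one : ca 1 = 0 := cl_rp 0

lemma ca_zero {g : alternatingGroup (Fin 7)} (h : ca g = 0) : g = 1 := by
  have := (ca_iff g 0).1 h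
  exact Subtype.ext (cycleType_eq_zero.1 this)

/-- odd permutation centralizing the non 7-cycle representatives -/
def od : Fin 8 → Perm (Fin 7) := ![swap 0 1, swap 4 6, swap 3 4, swap 0 3 * swap 1 4 * swap 2 5,
  swap 4 5, swap 5 6, swap 3 4, 1]

/-- non 7-cycles: conjugacy in the symmetric group is conjugacy in the alternating group -/
lemma ca_conjA (g : alternatingGroup (Fin 7)) (h7 : ca g ≠ 7) :
    ∃ h : alternatingGroup (Fin 7), g = h * ra (ca g) * h⁻¹ := by
  obtain ⟨π, hπ⟩ := ca_conj g
  have hod : ∀ i : Fin 8, i ≠ 7 → od i * rp i * (od i)⁻¹ = rp i ∧ sign (od i) = -1 := by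
    decide +kernel
  obtain ⟨o1, o2⟩ := hod _ h7
  rcases Int.units_eq_one_or (sign π) with h | h
  · refine ⟨⟨π, mem_alternatingGroup.2 h⟩, ?_⟩
    exact hπ
  · refine ⟨⟨π * od (ca g), mem_alternatingGroup.2 (by rw [map_mul, h, o2]; rfl)⟩, ?_⟩
    have := congrArg Subtype.val hπ
    rw [MulAut.conjNormal_apply] at this
    refine Subtype.ext (this.trans ?_)
    change π * rp (ca g) * π⁻¹ = (π * od (ca g)) * rp (ca g) * (π * od (ca g))⁻¹
    conv_lhs => rw [← o1]
    group

lemma ca_pow (g : alternatingGroup (Fin 7)) (k : ℕ) : ca (g ^ k) = cl (rp (ca g) ^ k) := by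
  obtain ⟨π, hπ⟩ := ca_conj g
  conv_lhs => rw [hπ]
  rw [← map_pow, ca_conjNormal]
  rfl

/-- element orders -/
def eo : Fin 8 → ℕ := ![1, 2, 3, 3, 4, 5, 6, 7]

lemma rp_eo : ∀ i, rp i ^ eo i = 1 := by decide +kernel

lemma pow_eo (g : alternatingGroup (Fin 7)) : g ^ eo (ca g) = 1 := by
  obtain ⟨π, hπ⟩ := ca_conj g
  have : ra (ca g) ^ eo (ca g) = 1 := Subtype.ext (rp_eo _)
  conv_lhs => rw [hπ, ca_conjNormal, ca_ra]
  rw [← map_pow, this, map_one]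

/-- inverting elements -/
def ri : Fin 8 → Perm (Fin 7) := ![1, 1, swap 1 2 * swap 3 4, swap 1 2 * swap 4 5,
  swap 1 3 * swap 4 5, swap 1 4 * swap 2 3, swap 1 2 * swap 3 4, 1]

lemma real_A (g : alternatingGroup (Fin 7)) (h7 : ca g ≠ 7) :
    ∃ h : alternatingGroup (Fin 7), h * g * h⁻¹ = g⁻¹ := by
  have key : ∀ i : Fin 8, i ≠ 7 → sign (ri i) = 1 ∧ ri i * rp i * (ri i)⁻¹ = (rp i)⁻¹ := by
    decide +kernel
  obtain ⟨k1, k2⟩ := key _ h7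
  obtain ⟨π, hπ⟩ := ca_conj g
  have e : (⟨ri (ca g), mem_alternatingGroup.2 k1⟩ : alternatingGroup (Fin 7)) * ra (ca g) *
    (⟨ri (ca g), mem_alternatingGroup.2 k1⟩)⁻¹ = (ra (ca g))⁻¹ := Subtype.ext k2
  refine ⟨MulAut.conjNormal π ⟨ri (ca g), mem_alternatingGroup.2 k1⟩, ?_⟩
  have e2 := congrArg (MulAut.conjNormal π) e
  rw [map_mul, map_mul, map_inv, map_inv, ← hπ] at e2
  exact e2

/-- squaring elements -/
def rs : Fin 8 → Perm (Fin 7) := ![1, 1, 1, 1, 1,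
  swap 1 2 * swap 2 4 * swap 4 3 * swap 5 6, 1,
  swap 1 2 * swap 2 4 * (swap 3 6 * swap 6 5)]

lemma sq_A (g : alternatingGroup (Fin 7)) (h57 : ca g = 5 ∨ ca g = 7) :
    ∃ h : alternatingGroup (Fin 7), h * g * h⁻¹ = g ^ 2 := by
  have key : ∀ i : Fin 8, i = 5 ∨ i = 7 →
      sign (rs i) = 1 ∧ rs i * rp i * (rs i)⁻¹ = (rp i) ^ 2 := by
    decide +kernel
  obtain ⟨k1, k2⟩ := key _ h57
  obtain ⟨π, hπ⟩ := ca_conj g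
  have e : (⟨rs (ca g), mem_alternatingGroup.2 k1⟩ : alternatingGroup (Fin 7)) * ra (ca g) *
    (⟨rs (ca g), mem_alternatingGroup.2 k1⟩)⁻¹ = (ra (ca g)) ^ 2 := Subtype.ext k2
  refine ⟨MulAut.conjNormal π ⟨rs (ca g), mem_alternatingGroup.2 k1⟩, ?_⟩
  have e2 := congrArg (MulAut.conjNormal π) e
  rw [map_mul, map_mul, map_inv, map_pow, ← hπ] at e2
  exact e2

lemma partner_A (g : alternatingGroup (Fin 7)) (h : ca g = 2 ∨ ca g = 3) :
    ∃ t : alternatingGroup (Fin 7), g * t = t * g ∧ t ^ 3 = 1 ∧ t ≠ 1 ∧ t ≠ g ∧ t ≠ g ^ 2 := by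
  have key : ∀ i : Fin 8, i = 2 ∨ i = 3 →
      sign (swap 3 4 * swap 4 5 : Perm (Fin 7)) = 1 ∧
      rp i * (swap 3 4 * swap 4 5) = (swap 3 4 * swap 4 5) * rp i ∧
      (swap 3 4 * swap 4 5 : Perm (Fin 7)) ^ 3 = 1 ∧
      (swap 3 4 * swap 4 5 : Perm (Fin 7)) ≠ 1 ∧
      (swap 3 4 * swap 4 5 : Perm (Fin 7)) ≠ rp i ∧
      (swap 3 4 * swap 4 5 : Perm (Fin 7)) ≠ rp i ^ 2 := by
    decide +kernel
  obtain ⟨k0, k1, k2, k3, k4, k5⟩ := key _ h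
  obtain ⟨π, hπ⟩ := ca_conj g
  set t : alternatingGroup (Fin 7) := ⟨swap 3 4 * swap 4 5, mem_alternatingGroup.2 k0⟩ with ht
  have e1 : ra (ca g) * t = t * ra (ca g) := Subtype.ext k1
  have e2 : t ^ 3 = 1 := Subtype.ext k2
  have inj := (MulAut.conjNormal π : MulAut (alternatingGroup (Fin 7))).injective
  refine ⟨MulAut.conjNormal π t, ?_, ?_, ?_, ?_, ?_⟩
  · have := congrArg (MulAut.conjNormal π) e1
    rw [map_mul, map_mul, ← hπ] at this
    exact this
  · rw [← map_pow, e2, map_one]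
  · intro hh
    exact k3 (congrArg Subtype.val (inj (hh.trans (map_one _).symm)))
  · intro hh
    exact k4 (congrArg Subtype.val (inj (hh.trans hπ)))
  · intro hh
    have : MulAut.conjNormal π t = MulAut.conjNormal π (ra (ca g) ^ 2) := by
      rw [map_pow, ← hπ]; exact hh
    exact k5 (congrArg Subtype.val (inj this))

end PartPC

section PartPC2
open Equiv Equiv.Perm

/-- list of double transpositions -/
def dtl : List (Perm (Fin 7)) :=
  (List.finRange 7).flatMap fun a => (List.finRange 7).flatMap fun b =>
  (List.finRange 7).flatMap fun c => (List.finRange 7).flatMap fun d =>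
    if a < b ∧ c < d ∧ a < c ∧ b ≠ c ∧ b ≠ d then [swap a b * swap c d] else []

/-- list of three-cycles -/
def tcl : List (Perm (Fin 7)) :=
  (List.finRange 7).flatMap fun a => (List.finRange 7).flatMap fun b =>
  (List.finRange 7).flatMap fun c =>
    if a < b ∧ a < c ∧ b ≠ c then [swap a b * swap b c] else []

/-- numerical code of a permutation -/
def pcode (σ : Perm (Fin 7)) : ℕ :=
  (σ 0).val + 7 * ((σ 1).val + 7 * ((σ 2).val + 7 * ((σ 3).val + 7 * ((σ 4).val + 7 *
    ((σ 5).val + 7 * (σ 6).val)))))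

lemma dtl_nodup : dtl.Nodup := by
  have h : dtl.map pcode = [800367, 795957, 750387, 330261, 798603, 767733, 448743, 786255, 570165, 699819, 799899,
    793389, 733371, 212361, 798513, 767643, 448653, 786165, 570075, 699729, 799599, 792459,
    732441, 211431, 794937, 749367, 329241, 785235, 569145, 698799, 791025, 790395, 723867,
    202857, 790773, 740793, 320667, 758139, 439149, 690225, 716595, 715965, 709455, 128427,
    716343, 711933, 246237, 714579, 364719, 486141, 94737, 94107, 87597, 27579, 94485, 90075,
    44505, 92721, 61851, 80373, 798567, 767697, 448707, 786219, 570129, 699783, 795291,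
    749721, 329595, 785589, 569499, 699153, 793191, 743211, 323085, 760557, 441567, 692643,
    733173, 728763, 263067, 731409, 381549, 502971, 212163, 207753, 162183, 210399, 179529,
    198051, 785967, 569877, 699531, 763035, 444045, 695121, 748335, 398475, 519897, 328209,
    297339, 315861, 697767, 537243, 434343] := by
    decide +kernel
  have h2 : (dtl.map pcode).Nodup := by
    rw [h]
    decide +kernel
  exact h2.of_map

lemma tcl_nodup : tcl.Nodup := by
  have h : tcl.map pcode = [800577, 799653, 791085, 716661, 94809, 800613, 799689, 791163, 716781, 94971, 799977,
    800229, 791409, 717321, 95805, 793461, 795771, 797241, 719037, 99579, 733437, 750153,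
    766029, 774261, 111585, 212421, 329979, 446697, 555771, 598989, 800037, 793569, 733593,
    212625, 800289, 793821, 734139, 213465, 795837, 797601, 735861, 217245, 750225, 766395,
    776685, 229257, 330057, 447069, 558201, 615825, 796257, 750981, 331149, 798021, 752745,
    334971, 766857, 779205, 347025, 447573, 560763, 632793, 769797, 452865, 782145, 465213,
    563997, 650433, 584577, 671013] := by
    decide +kernel
  have h2 : (tcl.map pcode).Nodup := by
    rw [h]
    decide +kernel
  exact h2.of_map

lemma dtl_len : dtl.length = 105 := by decide +kernel
lemma tcl_len : tcl.length = 70 := by decide +kernel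
lemma dtl_cl : (dtl.all fun σ => decide (cl σ = 1 ∧ sign σ = 1)) = true := by decide +kernel
lemma tcl_cl : (tcl.all fun σ => decide (cl σ = 2 ∧ sign σ = 1)) = true := by decide +kernel

/-- product counts -/
def pc1 : Fin 8 → ℕ := ![1, 8, 12, 24, 24, 24, 12, 0]
/-- product counts -/
def pc2 : Fin 8 → ℕ := ![1, 12, 13, 8, 0, 36, 0, 0]


lemma dtl_cnt : ∀ j, (dtl.map fun σ => cl (rp 1 * σ)).count j = pc1 j := by decide +kernel
lemma tcl_cnt : ∀ j, (tcl.map fun σ => cl (rp 2 * σ)).count j = pc2 j := by decide +kernel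

end PartPC2

section PartPC3
open Equiv Equiv.Perm

lemma list_sum_count (l : List (Fin 8)) (F : Fin 8 → ℂ) :
    (l.map F).sum = ∑ j, (l.count j : ℂ) * F j := by
  induction l with
  | nil => simp
  | cons a l ih =>
    rw [List.map_cons, List.sum_cons, ih]
    simp only [List.count_cons, Nat.cast_add, add_mul, Finset.sum_add_distrib]
    rw [add_comm]
    congr 1
    rw [Finset.sum_eq_single a]
    · simp
    · intro b _ hb
      simp [hb.symm]
    · simp

lemma sum_pc (L : List (Perm (Fin 7))) (i : Fin 8) (pc : Fin 8 → ℕ) (hn : L.Nodup)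
    (hl : L.length = cn i) (hcl : (L.all fun σ => decide (cl σ = i ∧ sign σ = 1)) = true)
    (hc : ∀ j, (L.map fun σ => cl (rp i * σ)).count j = pc j)
    (τ : alternatingGroup (Fin 7)) (hτ : ca τ = i) (F : Fin 8 → ℂ) :
    ∑ σ ∈ Finset.univ.filter (fun σ => ca σ = i), F (ca (τ * σ)) = ∑ j, (pc j : ℂ) * F j := by
  have hcl' : ∀ σ ∈ L, cl σ = i ∧ sign σ = 1 := by
    intro σ hσ
    have := List.all_eq_true.1 hcl σ hσ
    exact of_decide_eq_true this
  have hset : (Finset.univ.filter (fun σ : alternatingGroup (Fin 7) => ca σ = i)).map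
      (Function.Embedding.subtype _) = L.toFinset := by
    symm
    apply Finset.eq_of_subset_of_card_le
    · intro σ hσ
      obtain ⟨h1, h2⟩ := hcl' σ (List.mem_toFinset.1 hσ)
      rw [Finset.mem_map]
      exact ⟨⟨σ, mem_alternatingGroup.2 h2⟩, Finset.mem_filter.2 ⟨Finset.mem_univ _, h1⟩, rfl⟩
    · rw [Finset.card_map, card_ca, List.toFinset_card_of_nodup hn, hl]
  have hrep : ∑ σ ∈ Finset.univ.filter (fun σ => ca σ = i), F (ca (ra i * σ)) =
      ∑ j, (pc j : ℂ) * F j := by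
    have e1 : ∑ σ ∈ Finset.univ.filter (fun σ => ca σ = i), F (ca (ra i * σ)) =
        ∑ σ ∈ L.toFinset, F (cl (rp i * σ)) := by
      rw [← hset, Finset.sum_map]
      rfl
    rw [e1, List.sum_toFinset _ hn]
    have := list_sum_count (L.map fun σ => cl (rp i * σ)) F
    simp only [hc] at this
    rw [← this, List.map_map]
    rfl
  rw [← hrep]
  obtain ⟨π, hπ⟩ := ca_conj τ
  rw [hτ] at hπ
  symm
  refine Finset.sum_equiv (MulAut.conjNormal π : MulAut (alternatingGroup (Fin 7))).toEquiv ?_ ?_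
  · intro σ
    simp only [Finset.mem_filter, Finset.mem_univ, true_and]
    exact (by rw [← ca_conjNormal π σ]; rfl)
  · intro σ _
    rw [hπ]
    change _ = F (ca (MulAut.conjNormal π (ra i) * MulAut.conjNormal π σ))
    rw [← map_mul, ca_conjNormal]

lemma sum_pc1 (τ : alternatingGroup (Fin 7)) (hτ : ca τ = 1) (F : Fin 8 → ℂ) :
    ∑ σ ∈ Finset.univ.filter (fun σ => ca σ = 1), F (ca (τ * σ)) =
      F 0 + 8 * F 1 + 12 * F 2 + 24 * F 3 + 24 * F 4 + 24 * F 5 + 12 * F 6 := by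
  rw [sum_pc dtl 1 pc1 dtl_nodup dtl_len dtl_cl dtl_cnt τ hτ F]
  simp [Fin.sum_univ_eight, pc1]

lemma sum_pc2 (τ : alternatingGroup (Fin 7)) (hτ : ca τ = 2) (F : Fin 8 → ℂ) :
    ∑ σ ∈ Finset.univ.filter (fun σ => ca σ = 2), F (ca (τ * σ)) =
      F 0 + 12 * F 1 + 13 * F 2 + 8 * F 3 + 36 * F 5 := by
  rw [sum_pc tcl 2 pc2 tcl_nodup tcl_len tcl_cl tcl_cnt τ hτ F]
  simp [Fin.sum_univ_eight, pc2]

lemma no_seven (τ σ : alternatingGroup (Fin 7)) (hτ : ca τ = 1) (hσ : ca σ = 1) :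
    ca (τ * σ) ≠ 7 := by
  intro h7
  have h := sum_pc1 τ hτ (fun j => if j = 7 then 1 else 0)
  have h2 : (if ca (τ * σ) = 7 then (1 : ℝ) else 0) ≤
      ∑ σ ∈ Finset.univ.filter (fun σ => ca σ = 1), if ca (τ * σ) = 7 then (1 : ℝ) else 0 :=
    Finset.single_le_sum (f := fun σ => if ca (τ * σ) = 7 then (1 : ℝ) else 0)
      (fun _ _ => by split_ifs <;> norm_num) (by simp [hσ])
  have h3 : ∑ σ ∈ Finset.univ.filter (fun σ => ca σ = 1),
      (if ca (τ * σ) = 7 then (1 : ℝ) else 0) = 0 := by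
    have : ((∑ σ ∈ Finset.univ.filter (fun σ => ca σ = 1),
      (if ca (τ * σ) = 7 then (1 : ℝ) else 0) : ℝ) : ℂ) = 0 := by
      rw [Complex.ofReal_sum]
      refine Eq.trans (Finset.sum_congr rfl fun x _ => ?_) (h.trans (by simp))
      split_ifs <;> simp
    exact_mod_cast this
  rw [h3, if_pos h7] at h2
  norm_num at h2

end PartPC3

section PartPD
/-! ### Lifting elements to the cover -/

/-- real elements -/
def Rl {G : Type} [Group G] (y : G) : Prop := ∃ h, h * y * h⁻¹ = y⁻¹

lemma Rl.pow {G : Type} [Group G] {y : G} (hy : Rl y) (k : ℕ) : Rl (y ^ k) := by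
  obtain ⟨h, e⟩ := hy
  exact ⟨h, by rw [← conj_pow, e, inv_pow]⟩

lemma rl_of_sq {G : Type} [Group G] {y : G} (hy : y ^ 2 = 1) : Rl y :=
  ⟨1, by rw [eq_inv_iff_mul_eq_one]; simpa [sq] using hy⟩

section Lifts
variable {G : Type} [Group G]

lemma Cov.real_lift (C : Cov G) (σ : alternatingGroup (Fin 7)) (h7 : ca σ ≠ 7) :
    ∃ y, C.p y = σ ∧ Rl y := by
  obtain ⟨τ, hτ⟩ := real_A σ h7
  obtain ⟨y, rfl⟩ := C.surj σ
  obtain ⟨h, rfl⟩ := C.surj τ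
  obtain ⟨z, hz, e⟩ := C.diff (x := y⁻¹) (y := h * y * h⁻¹) (by
    rw [map_mul, map_mul, map_inv, map_inv, hτ])
  refine ⟨y * z, by rw [map_mul, C.mem.2 hz, mul_one], h, ?_⟩
  have hz3 := C.cube hz
  rw [Subgroup.mem_center_iff] at hz
  calc h * (y * z) * h⁻¹ = h * y * (z * h⁻¹) := by group
    _ = (h * y * h⁻¹) * z := by rw [← hz]; group
    _ = y⁻¹ * z ^ 2 := by rw [e, sq, mul_assoc]
    _ = y⁻¹ * z⁻¹ := by
      congr 1
      rw [eq_inv_iff_mul_eq_one, ← pow_succ]; exact hz3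
    _ = (y * z)⁻¹ := by rw [hz]; group

lemma Cov.real_pow (C : Cov G) {y : G} (hy : Rl y) {n : ℕ} (hn : C.p y ^ n = 1) : y ^ n = 1 := by
  have hz : y ^ n ∈ Subgroup.center G := C.mem.1 (by rw [map_pow, hn])
  have hz3 := C.cube hz
  obtain ⟨h, e⟩ := hy.pow n
  rw [Subgroup.mem_center_iff] at hz
  rw [hz, mul_inv_cancel_right, eq_inv_iff_mul_eq_one] at e
  calc y ^ n = (y ^ n) ^ 3 * (y ^ n * y ^ n)⁻¹ := by group
    _ = 1 := by rw [hz3, e]; simp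

lemma Cov.cop_uniq (C : Cov G) {y y' : G} {n : ℕ} (hn : Nat.Coprime n 3) (hp : C.p y = C.p y')
    (h : y ^ n = 1) (h' : y' ^ n = 1) : y = y' := by
  obtain ⟨z, hz, rfl⟩ := C.diff hp
  have hz3 := C.cube hz
  have hc : Commute y z := Subgroup.mem_center_iff.1 hz y
  rw [hc.mul_pow, h, one_mul] at h'
  have : z ^ (Nat.gcd n 3) = 1 := by
    rw [pow_gcd_eq_one]
    exact ⟨h', hz3⟩
  rw [hn.gcd_eq_one, pow_one] at this
  rw [this, mul_one]

lemma Cov.sum_lift [Fintype G] (C : Cov G) (f : alternatingGroup (Fin 7) → ℂ) :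
    ∑ g, f (C.p g) = 3 * ∑ σ, f σ := by
  classical
  rw [← Finset.sum_fiberwise (s := Finset.univ) (g := fun g => C.p g), Finset.mul_sum]
  refine Finset.sum_congr rfl fun σ _ => ?_
  rw [Finset.sum_congr rfl (g := fun _ => f σ) (fun g hg => by rw [(Finset.mem_filter.1 hg).2])]
  rw [Finset.sum_const, nsmul_eq_mul]
  congr 1
  have : (Finset.univ.filter fun g => C.p g = σ).card = 3 := by
    obtain ⟨y, rfl⟩ := C.surj σ
    have hcz := Nat.card_eq_card_finite_toFinset (Set.toFinite (Subgroup.center G : Set G))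
    rw [← C.cz]
    refine Eq.trans ?_ hcz.symm
    refine Finset.card_bij (fun g _ => y⁻¹ * g) ?_ ?_ ?_
    · intro g hg
      rw [Set.Finite.mem_toFinset]
      refine C.mem.1 ?_
      rw [map_mul, map_inv, (Finset.mem_filter.1 hg).2, inv_mul_cancel]
    · intro a _ b _ h
      exact mul_left_cancel h
    · intro b hb
      rw [Set.Finite.mem_toFinset] at hb
      refine ⟨y * b, ?_, by group⟩
      simp [C.mem.2 hb]
  exact_mod_cast this

lemma Cov.sum_cl [Fintype G] (C : Cov G) (F : Fin 8 → ℂ) :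
    ∑ g, F (ca (C.p g)) = 3 * (F 0 + 105 * F 1 + 70 * F 2 + 280 * F 3 + 630 * F 4 + 504 * F 5
      + 210 * F 6 + 720 * F 7) := by
  rw [C.sum_lift (fun σ => F (ca σ))]
  congr 1
  rw [← Finset.sum_fiberwise (s := Finset.univ) (g := fun σ => ca σ)]
  have : ∀ i, ∑ σ ∈ Finset.univ.filter (fun σ => ca σ = i), F (ca σ) = cn i * F i := by
    intro i
    rw [Finset.sum_congr rfl (g := fun _ => F i)
      (fun g hg => by rw [(Finset.mem_filter.1 hg).2])]
    rw [Finset.sum_const, nsmul_eq_mul, card_ca]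
  simp only [this]
  simp [Fin.sum_univ_eight, cn]

end Lifts

end PartPD

section PartPE
/-! ### Character values -/

set_option linter.unusedSectionVars false

section Values
variable {G : Type} [Group G] {M : Type} [AddCommGroup M] [Module ℂ M] [FiniteDimensional ℂ M]
  [Nontrivial M]

lemma central_scalar (R : Representation ℂ G M) (hR : Irr R) {z : G}
    (hz : z ∈ Subgroup.center G) : ∃ c : ℂ, R z = c • 1 := by
  refine schur R hR (R z) fun g => ?_
  rw [← map_mul, ← map_mul, (Subgroup.mem_center_iff.1 hz) g]

lemma scalar_pow (R : Representation ℂ G M) {z : G} {c : ℂ} (hc : R z = c • 1) {n : ℕ}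
    (hz : z ^ n = 1) : c ^ n = 1 := by
  have h1 : R (z ^ n) = c ^ n • 1 := by rw [map_pow, hc, smul_pow, one_pow]
  rw [hz, map_one] at h1
  obtain ⟨x, hx⟩ := exists_ne (0 : M)
  have := congrArg (fun f : Module.End ℂ M => f x) h1
  simp only [LinearMap.smul_apply, Module.End.one_apply] at this
  have h2 : (c ^ n - 1) • x = 0 := by rw [sub_smul, ← this, one_smul, sub_self]
  rcases smul_eq_zero.1 h2 with h | h
  · exact sub_eq_zero.1 h
  · exact absurd h hx

lemma char_scalar (R : Representation ℂ G M) {z : G} {c : ℂ} (hc : R z = c • 1) (y : G) :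
    R.character (y * z) = c * R.character y := by
  unfold Representation.character
  rw [map_mul, hc, mul_smul_comm, mul_one, map_smul, smul_eq_mul]

lemma char_scalar_inv (R : Representation ℂ G M) {z : G} {c : ℂ} (hc : R z = c • 1)
    (h3 : z ^ 3 = 1) (hzc : z ∈ Subgroup.center G) (y : G) :
    R.character (y * z)⁻¹ = c ^ 2 * R.character y⁻¹ := by
  have h2 : R (z ^ 2) = c ^ 2 • 1 := by rw [map_pow, hc, smul_pow, one_pow]
  have : (y * z)⁻¹ = y⁻¹ * z ^ 2 := by
    have e : z⁻¹ = z ^ 2 := by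
      rw [inv_eq_iff_mul_eq_one, ← pow_succ']; exact h3
    rw [mul_inv_rev, e]
    exact ((Subgroup.mem_center_iff.1 (Subgroup.pow_mem _ hzc 2)) y⁻¹).symm
  rw [this, char_scalar R h2]

lemma rl_char (R : Representation ℂ G M) {y : G} (hy : Rl y) :
    R.character y⁻¹ = R.character y := by
  obtain ⟨h, e⟩ := hy
  rw [← e, Representation.char_conj]

lemma phi_eq (C : Cov G) (R : Representation ℂ G M) (hR : Irr R) {x y : G}
    (h : C.p x = C.p y) :
    R.character x * R.character x⁻¹ = R.character y * R.character y⁻¹ := by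
  obtain ⟨z, hz, rfl⟩ := C.diff h
  obtain ⟨c, hc⟩ := central_scalar R hR hz
  have h3 := scalar_pow R hc (C.cube hz)
  rw [char_scalar R hc, char_scalar_inv R hc (C.cube hz) hz]
  linear_combination (-(R.character x * R.character x⁻¹)) * h3

lemma real_const (C : Cov G) (R : Representation ℂ G M) (hR : Irr R) {x y : G}
    (hx : Rl x) (hy : Rl y) (h7 : ca (C.p x) ≠ 7) (h : ca (C.p x) = ca (C.p y)) :
    R.character x = R.character y := by
  obtain ⟨s, hs⟩ := ca_conjA (C.p x) h7
  obtain ⟨t, ht⟩ := ca_conjA (C.p y) (h ▸ h7)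
  obtain ⟨u, hu⟩ := C.surj (t * s⁻¹)
  have e : C.p (u * x * u⁻¹) = C.p y := by
    rw [map_mul, map_mul, map_inv, hu, ht, ← h]
    conv_lhs => rw [hs]
    group
  obtain ⟨z, hz, e⟩ := C.diff e
  obtain ⟨c, hc⟩ := central_scalar R hR hz
  have h3 := scalar_pow R hc (C.cube hz)
  have e1 := char_scalar R hc (u * x * u⁻¹)
  have e2 := char_scalar_inv R hc (C.cube hz) hz (u * x * u⁻¹)
  have e3 : (u * x * u⁻¹)⁻¹ = u * x⁻¹ * u⁻¹ := by group
  rw [e3] at e2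
  rw [← e, Representation.char_conj] at e1 e2
  rw [rl_char R hx, rl_char R hy] at e2
  rw [e1] at e2
  rw [e1]
  by_cases h0 : R.character x = 0
  · rw [h0]; simp
  · have e4 := mul_right_cancel₀ h0 e2
    have hc1 : c = 1 := by
      have hcn : c ≠ 0 := by rintro rfl; norm_num at h3
      have : c * 1 = c * c := by rw [mul_one, ← sq]; exact e4
      exact (mul_left_cancel₀ hcn this).symm
    rw [hc1, one_mul]

lemma exists_v (C : Cov G) (R : Representation ℂ G M) (hR : Irr R) :
    ∃ v : Fin 8 → ℂ, (∀ i, i ≠ 7 → ∃ y, Rl y ∧ ca (C.p y) = i) ∧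
      (∀ y, Rl y → ca (C.p y) ≠ 7 → R.character y = v (ca (C.p y))) ∧
      (∀ g, ca (C.p g) ≠ 7 → R.character g * R.character g⁻¹ = v (ca (C.p g)) ^ 2) ∧
      v 0 = Module.finrank ℂ M := by
  have h : ∀ i, ∃ y, i ≠ 7 → Rl y ∧ ca (C.p y) = i := by
    intro i
    by_cases hi : i = 7
    · exact ⟨1, fun h => absurd hi h⟩
    · obtain ⟨y, h1, h2⟩ := C.real_lift (ra i) (by rw [ca_ra]; exact hi)
      exact ⟨y, fun _ => ⟨h2, by rw [h1, ca_ra]⟩⟩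
  choose f hf using h
  have key : ∀ y, Rl y → ca (C.p y) ≠ 7 → R.character y = R.character (f (ca (C.p y))) := by
    intro y hy h7
    obtain ⟨h1, h2⟩ := hf _ h7
    exact real_const C R hR hy h1 h7 h2.symm
  refine ⟨fun i => R.character (f i), fun i hi => ⟨f i, hf i hi⟩, key, ?_, ?_⟩
  · intro g h7
    obtain ⟨y, h1, h2⟩ := C.real_lift (C.p g) h7
    rw [← phi_eq C R hR h1, rl_char R h2, key y h2 (by rw [h1]; exact h7), h1, sq]
  · have h1 : Rl (1 : G) := rl_of_sq (one_pow 2)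
    have h2 : ca (C.p 1) = 0 := by rw [map_one, ca_one]
    have := key 1 h1 (by rw [h2]; decide)
    rw [h2, Representation.char_one] at this
    exact this.symm

lemma char_pow_eq (R : Representation ℂ G M) (y : G) (k : ℕ) :
    LinearMap.trace ℂ M (R y ^ k) = R.character (y ^ k) := by
  unfold Representation.character
  rw [map_pow R]

/-- integrality of the character values -/
lemma v_int (C : Cov G) (R : Representation ℂ G M) (hd : Module.finrank ℂ M = 6)
    (v : Fin 8 → ℂ) (hex : ∀ i, i ≠ 7 → ∃ y, Rl y ∧ ca (C.p y) = i)
    (hv : ∀ y, Rl y → ca (C.p y) ≠ 7 → R.character y = v (ca (C.p y))) :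
    ∃ a b c d x e : ℤ, v 1 = 6 - 4 * a ∧ v 2 = 6 - 3 * b ∧ v 3 = 6 - 3 * c ∧ v 4 = 2 * d ∧
      v 5 = 6 - 5 * x ∧ v 6 = 6 - v 2 + v 1 - 6 * e := by
  have hd' : (Module.finrank ℂ M : ℂ) = 6 := by rw [hd]; norm_num
  have key : ∀ (y : G) (i : Fin 8) (k : ℕ) (j : Fin 8), Rl y → ca (C.p y) = i →
      cl (rp i ^ k) = j → j ≠ 7 → LinearMap.trace ℂ M (R y ^ k) = v j := by
    intro y i k j hy hi hj h7
    have e : ca (C.p (y ^ k)) = j := by rw [map_pow, ca_pow, hi, hj]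
    rw [char_pow_eq, hv _ (hy.pow k) (by rw [e]; exact h7), e]
  have key1 : ∀ (y : G) (i : Fin 8), Rl y → ca (C.p y) = i → i ≠ 7 →
      LinearMap.trace ℂ M (R y) = v i := by
    intro y i hy hi h7
    have := hv y hy (by rw [hi]; exact h7)
    rw [hi] at this
    exact this
  have pw : ∀ (y : G) (i : Fin 8), Rl y → ca (C.p y) = i → R y ^ eo i = 1 := by
    intro y i hy hi
    rw [← map_pow, C.real_pow hy (by rw [← hi]; exact pow_eo _), map_one]
  obtain ⟨y2, r2, c2⟩ := hex 2 (by decide)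
  obtain ⟨y3, r3, c3⟩ := hex 3 (by decide)
  obtain ⟨y4, r4, c4⟩ := hex 4 (by decide)
  obtain ⟨y5, r5, c5⟩ := hex 5 (by decide)
  obtain ⟨y6, r6, c6⟩ := hex 6 (by decide)
  obtain ⟨b, hb⟩ := ord3 (R y2) (pw y2 2 r2 c2) (by
    rw [key y2 2 2 2 r2 c2 (by decide +kernel) (by decide), key1 y2 2 r2 c2 (by decide)])
  obtain ⟨c, hc⟩ := ord3 (R y3) (pw y3 3 r3 c3) (by
    rw [key y3 3 2 3 r3 c3 (by decide +kernel) (by decide), key1 y3 3 r3 c3 (by decide)])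
  obtain ⟨a, n, ha, hn⟩ := ord4 (R y4) (pw y4 4 r4 c4) (by
    rw [key y4 4 3 4 r4 c4 (by decide +kernel) (by decide), key1 y4 4 r4 c4 (by decide)])
  obtain ⟨x, hx⟩ := ord5 (R y5) (pw y5 5 r5 c5)
    (by rw [key y5 5 2 5 r5 c5 (by decide +kernel) (by decide), key1 y5 5 r5 c5 (by decide)])
    (by rw [key y5 5 3 5 r5 c5 (by decide +kernel) (by decide), key1 y5 5 r5 c5 (by decide)])
    (by rw [key y5 5 4 5 r5 c5 (by decide +kernel) (by decide), key1 y5 5 r5 c5 (by decide)])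
  obtain ⟨e, he⟩ := ord6 (R y6) (pw y6 6 r6 c6)
    (by rw [key y6 6 4 2 r6 c6 (by decide +kernel) (by decide),
      key y6 6 2 2 r6 c6 (by decide +kernel) (by decide)])
    (by rw [key y6 6 5 6 r6 c6 (by decide +kernel) (by decide), key1 y6 6 r6 c6 (by decide)])
  rw [key1 y2 2 r2 c2 (by decide), hd'] at hb
  rw [key1 y3 3 r3 c3 (by decide), hd'] at hc
  rw [key y4 4 2 1 r4 c4 (by decide +kernel) (by decide), hd'] at ha
  rw [key1 y4 4 r4 c4 (by decide), hd'] at hn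
  rw [key1 y5 5 r5 c5 (by decide), hd'] at hx
  rw [key1 y6 6 r6 c6 (by decide), key y6 6 2 2 r6 c6 (by decide +kernel) (by decide),
    key y6 6 3 1 r6 c6 (by decide +kernel) (by decide), hd'] at he
  refine ⟨a, b, c, n + a - 3, x, e, ha, hb, hc, ?_, hx, he⟩
  rw [hn]; push_cast; ring

lemma seven (C : Cov G) (R : Representation ℂ G M) (hR : Irr R) (hd : Module.finrank ℂ M = 6)
    (g : G) (h7 : ca (C.p g) = 7) :
    ∃ r : ℝ, 1 ≤ r ∧ R.character g * R.character g⁻¹ = r := by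
  obtain ⟨t, ht⟩ := sq_A (C.p g) (Or.inr h7)
  obtain ⟨h, rfl⟩ := C.surj t
  have hp7 : C.p g ^ 7 = 1 := by
    have := pow_eo (C.p g)
    rw [h7] at this
    exact this
  have hg7 : g ^ 7 ∈ Subgroup.center G := C.mem.1 (by rw [map_pow, hp7])
  have hg21 := C.cube hg7
  obtain ⟨y, hy⟩ : ∃ y, y = g ^ 15 := ⟨_, rfl⟩
  have hpy : C.p y = C.p g := by
    rw [hy, map_pow]
    calc C.p g ^ 15 = (C.p g ^ 7) ^ 2 * C.p g := by group
      _ = _ := by rw [hp7]; simp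
  have hy7 : y ^ 7 = 1 := by
    rw [hy, ← pow_mul]
    calc g ^ (15 * 7) = ((g ^ 7) ^ 3) ^ 5 := by rw [← pow_mul, ← pow_mul]
      _ = 1 := by rw [hg21, one_pow]
  have hc : h * y * h⁻¹ = y ^ 2 := by
    apply C.cop_uniq (n := 7) (by norm_num)
    · rw [map_mul, map_mul, map_inv, map_pow, hpy, ht]
    · rw [conj_pow, hy7]; simp
    · rw [← pow_mul, mul_comm, pow_mul, hy7, one_pow]
  have hck : ∀ k, R.character (y ^ (2 * k)) = R.character (y ^ k) := by
    intro k
    rw [pow_mul, ← hc, conj_pow, Representation.char_conj]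
  have h5 : R.character (y ^ 5) = R.character (y ^ 6) := by
    rw [← hck 6]
    congr 1
    calc y ^ 5 = y ^ 7 * y ^ 5 := by rw [hy7, one_mul]
      _ = _ := by rw [← pow_add]
  have h1 : R.character (y ^ 1) = LinearMap.trace ℂ M (R y) := by
    rw [pow_one]; rfl
  obtain ⟨r, hr, e⟩ := ord7 (R y) (by rw [← map_pow, hy7, map_one]) hd
    (by rw [char_pow_eq, ← h1]; exact hck 1)
    (by rw [char_pow_eq, ← h1, ← hck 1]; exact hck 2)
    (by rw [char_pow_eq, char_pow_eq]; exact (hck 3).symm)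
    (by rw [char_pow_eq, char_pow_eq]; exact h5)
  refine ⟨r, hr, ?_⟩
  rw [← phi_eq C R hR hpy, ← e, char_pow_eq]
  have : y⁻¹ = y ^ 6 := by
    rw [inv_eq_iff_mul_eq_one, ← pow_succ']; exact hy7
  rw [this]
  rfl

end Values

end PartPE

section PartPF
set_option linter.unusedSectionVars false

section Budget
variable {G : Type} [Group G] {M : Type} [AddCommGroup M] [Module ℂ M] [FiniteDimensional ℂ M]
  [Nontrivial M]

/-- the expected values of the norm of the character -/
def wv (v : Fin 8 → ℂ) (i : Fin 8) : ℂ := if i = 7 then 1 else v i ^ 2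

lemma budget [Fintype G] (C : Cov G) (R : Representation ℂ G M) (hR : Irr R)
    (hd : Module.finrank ℂ M = 6) (v : Fin 8 → ℂ)
    (hv : ∀ g, ca (C.p g) ≠ 7 → R.character g * R.character g⁻¹ = v (ca (C.p g)) ^ 2)
    (h0 : v 0 = 6) :
    ∃ D : ℝ, 0 ≤ D ∧ 36 + 105 * v 1 ^ 2 + 70 * v 2 ^ 2 + 280 * v 3 ^ 2 + 630 * v 4 ^ 2 +
      504 * v 5 ^ 2 + 210 * v 6 ^ 2 + 720 + D = 2520 ∧
      (D = 0 → ∀ g, R.character g * R.character g⁻¹ = wv v (ca (C.p g))) := by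
  have h : ∀ g, ∃ r : ℝ, 0 ≤ r ∧ R.character g * R.character g⁻¹ = wv v (ca (C.p g)) + r := by
    intro g
    by_cases h7 : ca (C.p g) = 7
    · obtain ⟨r, hr, e⟩ := seven C R hR hd g h7
      refine ⟨r - 1, by linarith, ?_⟩
      rw [e, wv, if_pos h7]; push_cast; ring
    · exact ⟨0, le_refl _, by rw [hv g h7, wv, if_neg h7]; simp⟩
  choose r hr he using h
  have hs := nrm_of_irr R hR
  simp only [he, Finset.sum_add_distrib] at hs
  rw [C.sum_cl (wv v), C.card] at hs
  refine ⟨(∑ g, r g) / 3, div_nonneg (Finset.sum_nonneg fun g _ => hr g) (by norm_num), ?_, ?_⟩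
  · have e0 : wv v 0 = 36 := by
      rw [wv, if_neg (by decide), h0]; norm_num
    have e7 : wv v 7 = 1 := by rw [wv, if_pos rfl]
    have e : ∀ i : Fin 8, i ≠ 7 → wv v i = v i ^ 2 := fun i hi => by rw [wv, if_neg hi]
    rw [e0, e7, e 1 (by decide), e 2 (by decide), e 3 (by decide), e 4 (by decide),
      e 5 (by decide), e 6 (by decide)] at hs
    push_cast at hs ⊢
    linear_combination hs / 3
  · intro hD g
    have h1 : ∑ g, r g = 0 := by linarith
    rw [Finset.sum_eq_zero_iff_of_nonneg (fun g _ => hr g)] at h1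
    rw [he g, h1 g (Finset.mem_univ g)]; simp

/-- arithmetic consequence of the budget -/
lemma arith (a b c d x e : ℤ) (D : ℝ) (hD : 0 ≤ D) (v : Fin 8 → ℂ)
    (h1 : v 1 = 6 - 4 * a) (h2 : v 2 = 6 - 3 * b) (h3 : v 3 = 6 - 3 * c) (h4 : v 4 = 2 * d)
    (h5 : v 5 = 6 - 5 * x) (h6 : v 6 = 6 - v 2 + v 1 - 6 * e)
    (hB : 36 + 105 * v 1 ^ 2 + 70 * v 2 ^ 2 + 280 * v 3 ^ 2 + 630 * v 4 ^ 2 +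
      504 * v 5 ^ 2 + 210 * v 6 ^ 2 + 720 + D = 2520)
    (hk : (v 2 = 0 ∧ v 3 = 0) ∨ ∃ k : ℤ, 6 + 4 * v 2 + 4 * v 3 = 9 * k) :
    D = 0 ∧ (v 1 = 2 ∨ v 1 = -2) ∧ v 3 = 0 ∧ v 4 = 0 ∧ v 5 = 1 ∧
      ((v 2 = 0 ∧ v 6 = v 1) ∨ (v 2 = 3 ∧ v 6 = - v 1 / 2)) := by
  have hR : (36 + 105 * (6 - 4 * a) ^ 2 + 70 * (6 - 3 * b) ^ 2 + 280 * (6 - 3 * c) ^ 2 +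
      630 * (2 * d) ^ 2 + 504 * (6 - 5 * x) ^ 2 +
      210 * (6 - (6 - 3 * b) + (6 - 4 * a) - 6 * e) ^ 2 + 720 + D : ℝ) = 2520 := by
    rw [h6, h1, h2, h3, h4, h5] at hB
    exact_mod_cast hB
  have hle : 36 + 105 * (6 - 4 * a) ^ 2 + 70 * (6 - 3 * b) ^ 2 + 280 * (6 - 3 * c) ^ 2 +
      630 * (2 * d) ^ 2 + 504 * (6 - 5 * x) ^ 2 +
      210 * (6 - (6 - 3 * b) + (6 - 4 * a) - 6 * e) ^ 2 + 720 ≤ 2520 := by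
    have : (36 + 105 * (6 - 4 * a) ^ 2 + 70 * (6 - 3 * b) ^ 2 + 280 * (6 - 3 * c) ^ 2 +
      630 * (2 * d) ^ 2 + 504 * (6 - 5 * x) ^ 2 +
      210 * (6 - (6 - 3 * b) + (6 - 4 * a) - 6 * e) ^ 2 + 720 : ℝ) ≤ 2520 := by linarith
    exact_mod_cast this
  set A := 6 - 4 * a with hA
  set B := 6 - 3 * b with hB'
  set C := 6 - 3 * c with hC
  set X := 6 - 5 * x with hX
  set E := 6 - B + A - 6 * e with hE
  have qA := sq_nonneg A
  have qB := sq_nonneg B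
  have qC := sq_nonneg C
  have qd := sq_nonneg (2 * d)
  have qX := sq_nonneg X
  have qE := sq_nonneg E
  have bA : A ^ 2 ≤ 4 ^ 2 := by nlinarith
  have bA' := abs_le_of_sq_le_sq' bA (by norm_num)
  have iA : a = 1 ∨ a = 2 := by omega
  have qA4 : A ^ 2 = 4 := by rcases iA with h | h <;> rw [hA, h] <;> norm_num
  have bX : X ^ 2 ≤ 2 ^ 2 := by nlinarith
  have bX' := abs_le_of_sq_le_sq' bX (by norm_num)
  have iX : x = 1 := by omega
  have qX1 : X = 1 := by rw [hX, iX]; norm_num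
  rw [qX1, qA4] at hle
  have bd : (2 * d) ^ 2 ≤ 1 ^ 2 := by nlinarith
  have bd' := abs_le_of_sq_le_sq' bd (by norm_num)
  have id0 : d = 0 := by omega
  have bC : C ^ 2 ≤ 2 ^ 2 := by nlinarith
  have bC' := abs_le_of_sq_le_sq' bC (by norm_num)
  have iC : C = 0 := by omega
  have ic : c = 2 := by omega
  have bB : B ^ 2 ≤ 4 ^ 2 := by nlinarith
  have bB' := abs_le_of_sq_le_sq' bB (by norm_num)
  have bE : E ^ 2 ≤ 2 ^ 2 := by nlinarith
  have bE' := abs_le_of_sq_le_sq' bE (by norm_num)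
  have hb : B = 0 ∨ B = 3 := by
    rcases hk with ⟨k1, -⟩ | ⟨k, hk⟩
    · left
      rw [h2] at k1
      have : (6 - 3 * b : ℤ) = 0 := by exact_mod_cast k1
      exact this
    · right
      rw [h2, h3] at hk
      have hk' : 6 + 4 * (6 - 3 * b) + 4 * (6 - 3 * c) = 9 * k := by exact_mod_cast hk
      omega
  have fin : (A = 2 ∨ A = -2) ∧ ((B = 0 ∧ E = A) ∨ (B = 3 ∧ 2 * E = -A)) := by
    have iA' : A = 2 ∨ A = -2 := by omega
    refine ⟨iA', ?_⟩
    rcases hb with hb | hb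
    · left; exact ⟨hb, by omega⟩
    · right
      refine ⟨hb, ?_⟩
      rw [hb] at hle
      have bE2 : E ^ 2 ≤ 1 ^ 2 := by nlinarith
      have bE2' := abs_le_of_sq_le_sq' bE2 (by norm_num)
      omega
  have cA : v 1 = (A : ℂ) := by rw [h1, hA]; push_cast; ring
  have cB : v 2 = (B : ℂ) := by rw [h2, hB']; push_cast; ring
  have cC : v 3 = (C : ℂ) := by rw [h3, hC]; push_cast; ring
  have cX : v 5 = (X : ℂ) := by rw [h5, hX]; push_cast; ring
  have cE : v 6 = (E : ℂ) := by rw [h6, hE, cA, cB]; push_cast; ring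
  have c3 : v 3 = 0 := by rw [cC, iC]; simp
  have c4 : v 4 = 0 := by rw [h4, id0]; simp
  have c5 : v 5 = 1 := by rw [cX, qX1]; simp
  have c1 : v 1 = 2 ∨ v 1 = -2 := by
    rw [cA]
    rcases fin.1 with h | h <;> rw [h]
    · left; norm_num
    · right; norm_num
  have c6 : (v 2 = 0 ∧ v 6 = v 1) ∨ (v 2 = 3 ∧ v 6 = - v 1 / 2) := by
    rcases fin.2 with ⟨h, h'⟩ | ⟨h, h'⟩
    · left; rw [cB, cE, cA, h, h']; simp
    · right
      rw [cB, cE, cA, h]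
      refine ⟨by norm_num, ?_⟩
      have : (2 * E : ℂ) = - A := by exact_mod_cast h'
      rw [← this]; ring
  refine ⟨?_, c1, c3, c4, c5, c6⟩
  have hDc : (D : ℂ) = 0 := by
    rcases c6 with ⟨h, h'⟩ | ⟨h, h'⟩ <;> rw [h, h', c3, c4, c5] at hB <;>
      rcases c1 with h1 | h1 <;> rw [h1] at hB <;> linear_combination hB
  exact_mod_cast hDc

/-- packaged character data -/
structure CharData [Fintype G] (C : Cov G) (R : Representation ℂ G M) (v : Fin 8 → ℂ) : Prop where
  re : ∀ y, Rl y → ca (C.p y) ≠ 7 → R.character y = v (ca (C.p y))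
  ph : ∀ g, R.character g * R.character g⁻¹ = wv v (ca (C.p g))
  v0 : v 0 = 6
  v1 : v 1 = 2 ∨ v 1 = -2
  v3 : v 3 = 0
  v4 : v 4 = 0
  v5 : v 5 = 1

lemma dataV [Fintype G] (C : Cov G) (R : Representation ℂ G M) (hR : Irr R)
    (hd : Module.finrank ℂ M = 6) (hinj : Function.Injective R) :
    ∃ v, CharData C R v ∧ v 2 = 0 ∧ v 6 = v 1 := by
  obtain ⟨v, hex, hre, hph, h0⟩ := exists_v C R hR
  have h0' : v 0 = 6 := by rw [h0, hd]; norm_num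
  have hz : ∀ i : Fin 8, i = 2 ∨ i = 3 → v i = 0 := by
    intro i hi
    have h7 : i ≠ 7 := by rcases hi with rfl | rfl <;> decide
    obtain ⟨x, rx, cx⟩ := hex i h7
    obtain ⟨t, t1, t2, t3, t4, t5⟩ := partner_A (C.p x) (by rw [cx]; exact hi)
    obtain ⟨y, rfl⟩ := C.surj t
    have hx3 : C.p x ^ 3 = 1 := by
      have := pow_eo (C.p x)
      rw [cx] at this
      rcases hi with rfl | rfl <;> exact this
    have hx1 : C.p x ≠ 1 := by
      intro h
      rw [h, ca_one] at cx
      rcases hi with rfl | rfl <;> exact absurd cx (by decide)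
    have hnc := C.noncomm x y hx3 t2 hx1 t3 t4 t5
    obtain ⟨z, hz, e⟩ := C.diff (x := x) (y := y * x * y⁻¹) (by
      rw [map_mul, map_mul, map_inv, ← t1, mul_inv_cancel_right])
    obtain ⟨c, hc⟩ := central_scalar R hR hz
    have hc1 : c ≠ 1 := by
      rintro rfl
      rw [one_smul, ← map_one R] at hc
      rw [hinj hc, mul_one, mul_inv_eq_iff_eq_mul] at e
      exact hnc e.symm
    have e2 := char_scalar R hc x
    rw [← e, Representation.char_conj, hre x rx (by rw [cx]; exact h7), cx] at e2
    have : (c - 1) * v i = 0 := by rw [sub_mul, ← e2]; ring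
    rcases mul_eq_zero.1 this with h | h
    · exact absurd (sub_eq_zero.1 h) hc1
    · exact h
  obtain ⟨a, b, c, d, x, e, i1, i2, i3, i4, i5, i6⟩ := v_int C R hd v hex hre
  obtain ⟨D, hD, hB, hz0⟩ := budget C R hR hd v hph h0'
  obtain ⟨k0, k1, k3, k4, k5, k6⟩ := arith a b c d x e D hD v i1 i2 i3 i4 i5 i6 hB
    (Or.inl ⟨hz 2 (Or.inl rfl), hz 3 (Or.inr rfl)⟩)
  refine ⟨v, ⟨hre, hz0 k0, h0', k1, k3, k4, k5⟩, hz 2 (Or.inl rfl), ?_⟩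
  rcases k6 with ⟨-, h⟩ | ⟨h, -⟩
  · exact h
  · rw [hz 2 (Or.inl rfl)] at h; norm_num at h

lemma dataU [Fintype G] (C : Cov G) (R : Representation ℂ G M) (hR : Irr R)
    (hd : Module.finrank ℂ M = 6) (hZ : ∀ z ∈ Subgroup.center G, R z = 1) :
    ∃ v, CharData C R v ∧ v 2 = 3 ∧ v 6 = - v 1 / 2 ∧
      ∀ g, ca (C.p g) ≠ 7 → R.character g = v (ca (C.p g)) := by
  obtain ⟨v, hex, hre, hph, h0⟩ := exists_v C R hR
  have h0' : v 0 = 6 := by rw [h0, hd]; norm_num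
  have hpR : ∀ x y, C.p x = C.p y → R x = R y := by
    intro x y h
    obtain ⟨z, hz, rfl⟩ := C.diff h
    rw [map_mul, hZ z hz, mul_one]
  have hall : ∀ g, ca (C.p g) ≠ 7 → R.character g = v (ca (C.p g)) := by
    intro g h7
    obtain ⟨y, h1, h2⟩ := C.real_lift (C.p g) h7
    have := hre y h2 (by rw [h1]; exact h7)
    rw [h1] at this
    rw [← this]
    unfold Representation.character
    rw [hpR y g h1]
  have hk : ∃ k : ℤ, 6 + 4 * v 2 + 4 * v 3 = 9 * k := by
    obtain ⟨x, hx⟩ := C.surj (ra 2)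
    have hs : Equiv.Perm.sign (Equiv.swap 3 4 * Equiv.swap 4 5 : Equiv.Perm (Fin 7)) = 1 := by
      decide +kernel
    obtain ⟨t, ht⟩ := C.surj ⟨_, Equiv.Perm.mem_alternatingGroup.2 hs⟩
    have e3 : R x ^ 3 = 1 := by
      rw [← map_pow]
      refine (hpR _ 1 ?_).trans (map_one R)
      rw [map_pow, hx, map_one]
      exact Subtype.ext (rp_eo 2)
    have t3 : R t ^ 3 = 1 := by
      rw [← map_pow]
      refine (hpR _ 1 ?_).trans (map_one R)
      rw [map_pow, ht, map_one]
      refine Subtype.ext ?_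
      change (Equiv.swap 3 4 * Equiv.swap 4 5 : Equiv.Perm (Fin 7)) ^ 3 = 1
      decide +kernel
    have hc : R x * R t = R t * R x := by
      rw [← map_mul, ← map_mul]
      apply hpR
      rw [map_mul, map_mul, hx, ht]
      refine Subtype.ext ?_
      change rp 2 * (Equiv.swap 3 4 * Equiv.swap 4 5 : Equiv.Perm (Fin 7)) =
        (Equiv.swap 3 4 * Equiv.swap 4 5 : Equiv.Perm (Fin 7)) * rp 2
      decide +kernel
    obtain ⟨m, hm⟩ := mult_nat2 (R x) (R t) 3 (by norm_num) e3 t3 hc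
    have key : ∀ i j (k : Fin 8),
        cl (rp 2 ^ i * (Equiv.swap 3 4 * Equiv.swap 4 5 : Equiv.Perm (Fin 7)) ^ j) = k → k ≠ 7 →
        LinearMap.trace ℂ M (R x ^ i * R t ^ j) = v k := by
      intro i j k h1 h7
      have e : ca (C.p (x ^ i * t ^ j)) = k := by
        rw [map_mul, map_pow, map_pow, hx, ht]
        exact h1
      have := hall (x ^ i * t ^ j) (by rw [e]; exact h7)
      rw [e] at this
      rw [← this]
      unfold Representation.character
      rw [map_mul R, map_pow R, map_pow R]
    refine ⟨m, ?_⟩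
    simp only [Finset.sum_range_succ, Finset.range_zero, Finset.sum_empty] at hm
    rw [key 0 0 0 (by decide +kernel) (by decide), key 0 1 2 (by decide +kernel) (by decide),
      key 0 2 2 (by decide +kernel) (by decide), key 1 0 2 (by decide +kernel) (by decide),
      key 2 0 2 (by decide +kernel) (by decide), key 1 1 3 (by decide +kernel) (by decide),
      key 1 2 3 (by decide +kernel) (by decide), key 2 1 3 (by decide +kernel) (by decide),
      key 2 2 3 (by decide +kernel) (by decide), h0'] at hm
    push_cast at hm ⊢
    linear_combination hm
  obtain ⟨a, b, c, d, x, e, i1, i2, i3, i4, i5, i6⟩ := v_int C R hd v hex hre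
  obtain ⟨D, hD, hB, hz0⟩ := budget C R hR hd v hph h0'
  obtain ⟨k0, k1, k3, k4, k5, k6⟩ := arith a b c d x e D hD v i1 i2 i3 i4 i5 i6 hB (Or.inr hk)
  have hv2 : v 2 = 3 ∧ v 6 = - v 1 / 2 := by
    rcases k6 with ⟨h, -⟩ | h
    · exfalso
      obtain ⟨k, hk⟩ := hk
      rw [h, k3] at hk
      have : (6 : ℤ) = 9 * k := by
        have h2 : (6 : ℂ) = 9 * k := by linear_combination hk
        exact_mod_cast h2
      omega
    · exact h
  exact ⟨v, ⟨hre, hz0 k0, h0', k1, k3, k4, k5⟩, hv2.1, hv2.2, hall⟩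

end Budget

end PartPF

section PartPH
set_option linter.unusedSectionVars false

section Dims
variable {G : Type} [Group G] {M : Type} [AddCommGroup M] [Module ℂ M] [FiniteDimensional ℂ M]

lemma irred_of_irr (σ : Representation ℂ G M) (W : Submodule ℂ M) (h : IsSubrep σ W)
    (hb : W ≠ ⊥) (hi : Irr (restr σ W h)) : IsIrredSubrep σ W := by
  have n1 : Nontrivial W := Submodule.nontrivial_iff_ne_bot.2 hb
  have := (irred_map σ (restr σ W h) hi W.subtype W.subtype_injective (fun g x => rfl)).1
  rwa [Submodule.range_subtype] at this

/-- two irreducible constituents whose dimensions are determined by a class sum -/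
lemma two_dims [Fintype G] (σ : Representation ℂ G M)
    (h2 : ∑ g, σ.character g * σ.character g⁻¹ = Nat.card G * 2)
    (K : Finset G) (hK : ∀ g k, k ∈ K → g * k * g⁻¹ ∈ K) (s S : ℤ)
    (hs : ∀ k ∈ K, σ.character k = s)
    (hne : K.Nonempty)
    (hS : ∑ k ∈ K, ∑ l ∈ K, σ.character (k * l) = S)
    (hc : ∀ (W : Submodule ℂ M) (h : IsSubrep σ W), W ≠ ⊥ → Irr (restr σ W h) →
      ∃ x : ℤ, ∀ k ∈ K, (restr σ W h).character k = x) (a b : ℕ)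
    (har : ∀ (p q : ℕ) (x : ℤ), 0 < p → 0 < q → p + q = Module.finrank ℂ M →
      (K.card * x) ^ 2 * q + (K.card * (s - x)) ^ 2 * p = S * p * q →
      (p = a ∧ q = b) ∨ (p = b ∧ q = a)) :
    ∃ W W' : Submodule ℂ M, IsCompl W W' ∧ IsIrredSubrep σ W ∧ Module.finrank ℂ W = a ∧
      IsIrredSubrep σ W' ∧ Module.finrank ℂ W' = b := by
  obtain ⟨W, W', h, h', hcm, hb, hb', hi, hi'⟩ := two_irr σ h2
  have n1 : Nontrivial W := Submodule.nontrivial_iff_ne_bot.2 hb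
  have n2 : Nontrivial W' := Submodule.nontrivial_iff_ne_bot.2 hb'
  obtain ⟨x, hx⟩ := hc W h hb hi
  obtain ⟨y, hy⟩ := hc W' h' hb' hi'
  have hadd := char_add σ W W' h h' hcm
  have hxy : y = s - x := by
    obtain ⟨k, hk⟩ := hne
    have := hadd k
    rw [hs k hk, hx k hk, hy k hk] at this
    have : s = x + y := by exact_mod_cast this
    omega
  have c1 := class_sum (restr σ W h) hi K hK
  have c2 := class_sum (restr σ W' h') hi' K hK
  rw [Finset.sum_congr rfl hx, Finset.sum_const, nsmul_eq_mul] at c1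
  rw [Finset.sum_congr rfl hy, Finset.sum_const, nsmul_eq_mul] at c2
  simp only [hadd, Finset.sum_add_distrib] at hS
  set p := Module.finrank ℂ W with hp
  set q := Module.finrank ℂ W' with hq
  have key : ((K.card * x) ^ 2 * q + (K.card * y) ^ 2 * p : ℂ) = S * p * q := by
    rw [← c1, ← c2, ← hS]; ring
  have key' : (K.card * x) ^ 2 * q + (K.card * y) ^ 2 * p = S * p * q := by exact_mod_cast key
  rw [hxy] at key'
  have i1 := irred_of_irr σ W h hb hi
  have i2 := irred_of_irr σ W' h' hb' hi'
  rcases har p q x Module.finrank_pos Module.finrank_pos (Submodule.finrank_add_eq_of_isCompl hcm)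
    key' with ⟨e1, e2⟩ | ⟨e1, e2⟩
  · exact ⟨W, W', hcm, i1, e1, i2, e2⟩
  · exact ⟨W', W, hcm.symm, i2, e2, i1, e1⟩

lemma irred_push (σ : Representation ℂ G M) (W : Submodule ℂ M) (h : IsSubrep σ W)
    (A : Submodule ℂ W) (hA : IsIrredSubrep (restr σ W h) A) :
    IsIrredSubrep σ (A.map W.subtype) := by
  obtain ⟨h1, h2, h3⟩ := hA
  refine ⟨?_, ?_, ?_⟩
  · rintro g _ ⟨x, hx, rfl⟩
    exact ⟨restr σ W h g x, h1 g x hx, rfl⟩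
  · intro hb
    exact h2 (Submodule.map_injective_of_injective W.subtype_injective
      (hb.trans (Submodule.map_bot _).symm))
  · intro X hX hsX
    have hm : (X.comap W.subtype).map W.subtype = X := by
      rw [Submodule.map_comap_eq, Submodule.range_subtype, inf_eq_right]
      refine hX.trans ?_
      rintro _ ⟨x, -, rfl⟩
      exact x.2
    have hle : X.comap W.subtype ≤ A := by
      intro x hx
      obtain ⟨y, hy, e⟩ := hX hx
      rwa [← W.subtype_injective e]
    rcases h3 _ hle (fun g x hx => hsX g _ hx) with e | e
    · left; rw [← hm, e, Submodule.map_bot]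
    · right; rw [← hm, e]

lemma arith1 (p q : ℕ) (x : ℤ) (hp : 0 < p) (hq : 0 < q) (h : p + q = 35)
    (e : ((210 : ℕ) * x) ^ 2 * q + ((210 : ℕ) * (-1 - x)) ^ 2 * p = 31500 * p * q) :
    (p = 14 ∧ q = 21) ∨ (p = 21 ∧ q = 14) := by
  obtain rfl : q = 35 - p := by omega
  have hp' : p ≤ 34 := by omega
  have e2 : (((35 - p : ℕ) : ℤ)) = 35 - p := by omega
  rw [e2] at e
  have e3 : 7 * (35 * x ^ 2 + 2 * x * p + p) = 5 * p * (35 - p) := by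
    push_cast at e
    linarith
  have hx : x ^ 2 ≤ 5 ^ 2 := by nlinarith [sq_nonneg (5 * p + 7 * x)]
  have hx' := abs_le_of_sq_le_sq' hx (by norm_num)
  obtain ⟨x1, x2⟩ := hx'
  have h7 : p = 7 ∨ p = 14 ∨ p = 21 ∨ p = 28 := by
    generalize x ^ 2 = X at e3
    interval_cases p <;> omega
  rcases h7 with rfl | rfl | rfl | rfl
  · exfalso; interval_cases x <;> norm_num at e3
  · left; omega
  · right; omega
  · exfalso; interval_cases x <;> norm_num at e3

lemma arith2 (s : ℤ) (hs : s = 4 ∨ s = -4) (p q : ℕ) (x : ℤ) (hp : 0 < p) (hq : 0 < q)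
    (h : p + q = 36)
    (e : ((105 : ℕ) * x) ^ 2 * q + ((105 : ℕ) * (s - x)) ^ 2 * p = (105 * (60 + 2 * s)) * p * q) :
    (p = 15 ∧ q = 21) ∨ (p = 21 ∧ q = 15) := by
  obtain rfl : q = 36 - p := by omega
  have hp' : p ≤ 35 := by omega
  have e2 : (((36 - p : ℕ) : ℤ)) = 36 - p := by omega
  rw [e2] at e
  have e3 : 105 * (36 * x ^ 2 - 2 * s * x * p + s ^ 2 * p) = (60 + 2 * s) * p * (36 - p) := by
    push_cast at e
    linarith
  generalize x ^ 2 = X at e3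
  rcases hs with rfl | rfl <;> clear e <;> interval_cases p <;> omega

lemma int2 [Fintype G] [Nontrivial M] (C : Cov G) (R : Representation ℂ G M) (hR : Irr R) :
    ∃ x : ℤ, ∀ k, k ^ 2 = 1 → ca (C.p k) = 1 → R.character k = x := by
  obtain ⟨v, hex, hre, -⟩ := exists_v C R hR
  obtain ⟨y, hy, hc⟩ := hex 1 (by decide)
  have y2 : y ^ 2 = 1 := C.real_pow hy (by have := pow_eo (C.p y); rw [hc] at this; exact this)
  obtain ⟨m, hm⟩ := ord2 (R y) (by rw [← map_pow, y2, map_one])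
  refine ⟨Module.finrank ℂ M - 2 * m, fun k hk hk1 => ?_⟩
  rw [hre k (rl_of_sq hk) (by rw [hk1]; decide), hk1, ← hc, ← hre y hy (by rw [hc]; decide)]
  unfold Representation.character
  rw [hm]; push_cast; rfl

lemma int3 [Fintype G] [Nontrivial M] (C : Cov G) (R : Representation ℂ G M) (hR : Irr R)
    (hZ : ∀ z ∈ Subgroup.center G, R z = 1) :
    ∃ x : ℤ, ∀ k, ca (C.p k) = 2 → R.character k = x := by
  obtain ⟨v, hex, hre, -⟩ := exists_v C R hR
  obtain ⟨y, hy, hc⟩ := hex 2 (by decide)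
  have y3 : y ^ 3 = 1 := C.real_pow hy (by have := pow_eo (C.p y); rw [hc] at this; exact this)
  obtain ⟨m, hm⟩ := ord3 (R y) (by rw [← map_pow, y3, map_one]) (by
    rw [char_pow_eq, show y ^ 2 = y⁻¹ by rw [eq_inv_iff_mul_eq_one, ← pow_succ, y3],
      rl_char R hy]; rfl)
  refine ⟨Module.finrank ℂ M - 3 * m, fun k hk1 => ?_⟩
  obtain ⟨y', h1, h2⟩ := C.real_lift (C.p k) (by rw [hk1]; decide)
  have e : R.character k = R.character y' := by
    obtain ⟨z, hz, rfl⟩ := C.diff h1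
    unfold Representation.character
    rw [map_mul, hZ z hz, mul_one]
  rw [e, hre y' h2 (by rw [h1, hk1]; decide), h1, hk1, ← hc, ← hre y hy (by rw [hc]; decide)]
  unfold Representation.character
  rw [hm]; push_cast; rfl

end Dims

section Main
variable {G : Type} [Group G] {V : Type} [AddCommGroup V] [Module ℂ V] [FiniteDimensional ℂ V]

lemma restr_one {M : Type} [AddCommGroup M] [Module ℂ M]
    (σ : Representation ℂ G M) (W : Submodule ℂ M) (h : IsSubrep σ W) {z : G}
    (hz : σ z = 1) : restr σ W h z = 1 := by
  ext x
  rw [restr_apply, hz]; rfl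

lemma int3_restr {M : Type} [AddCommGroup M] [Module ℂ M] [FiniteDimensional ℂ M] [Fintype G]
    (C : Cov G) (η : Representation ℂ G M) (hZ : ∀ z ∈ Subgroup.center G, η z = 1)
    (X : Submodule ℂ M) (hX : IsSubrep η X) (hb : X ≠ ⊥) (hiX : Irr (restr η X hX)) :
    ∃ x : ℤ, ∀ k, ca (C.p k) = 2 → (restr η X hX).character k = x := by
  have n1 : Nontrivial X := Submodule.nontrivial_iff_ne_bot.2 hb
  exact int3 C (restr η X hX) hiX (fun z hz => restr_one η X hX (hZ z hz))

lemma part1 [Fintype G] [Nontrivial V] (C : Cov G) (ρ : Representation ℂ G V)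
    (hinj : Function.Injective ρ) (hd : Module.finrank ℂ V = 6) (hi : Irr ρ) :
    ∃ W₀ W₁ W₂ : Submodule ℂ (V ⊗[ℂ] Module.Dual ℂ V),
      iSupIndep ![W₀, W₁, W₂] ∧ W₀ ⊔ W₁ ⊔ W₂ = ⊤ ∧
      IsSubrep (ρ.tprod ρ.dual) W₀ ∧ Module.finrank ℂ W₀ = 1 ∧
        TrivialOn (ρ.tprod ρ.dual) W₀ ∧
      IsIrredSubrep (ρ.tprod ρ.dual) W₁ ∧ Module.finrank ℂ W₁ = 14 ∧
        (∃ g : G, g ≠ 1 ∧ ∀ x ∈ W₁, (ρ.tprod ρ.dual) g x = x) ∧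
      IsIrredSubrep (ρ.tprod ρ.dual) W₂ ∧ Module.finrank ℂ W₂ = 21 ∧
        (∃ g : G, g ≠ 1 ∧ ∀ x ∈ W₂, (ρ.tprod ρ.dual) g x = x) := by
  classical
  obtain ⟨v, D, v2, v6⟩ := dataV C ρ hi hd hinj
  set σ : Representation ℂ G (V ⊗[ℂ] Module.Dual ℂ V) := ρ.tprod ρ.dual with hσ
  have hχ : ∀ g, σ.character g = wv v (ca (C.p g)) := by
    intro g
    rw [hσ, Representation.char_tensor, ← D.ph, Pi.mul_apply, Representation.char_dual]
  have v1 : v 1 ^ 2 = 4 := by rcases D.v1 with h | h <;> rw [h] <;> norm_num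
  have w0 : wv v 0 = 36 := by rw [wv, if_neg (by decide), D.v0]; norm_num
  have w1 : wv v 1 = 4 := by rw [wv, if_neg (by decide), v1]
  have w2 : wv v 2 = 0 := by rw [wv, if_neg (by decide), v2]; norm_num
  have w3 : wv v 3 = 0 := by rw [wv, if_neg (by decide), D.v3]; norm_num
  have w4 : wv v 4 = 0 := by rw [wv, if_neg (by decide), D.v4]; norm_num
  have w5 : wv v 5 = 1 := by rw [wv, if_neg (by decide), D.v5]; norm_num
  have w6 : wv v 6 = 4 := by rw [wv, if_neg (by decide), v6, v1]
  have w7 : wv v 7 = 1 := by rw [wv, if_pos rfl]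
  have hZ : ∀ z ∈ Subgroup.center G, σ z = 1 := by
    intro z hz
    obtain ⟨c, hc⟩ := central_scalar ρ hi hz
    obtain ⟨c', hc'⟩ := central_scalar ρ hi (Subgroup.inv_mem _ hz)
    have hcc : c * c' = 1 := by
      have : ρ z * ρ z⁻¹ = 1 := by rw [← map_mul, mul_inv_cancel, map_one]
      rw [hc, hc', smul_mul_smul_comm, one_mul] at this
      obtain ⟨x, hx⟩ := exists_ne (0 : V)
      have h2 := congrArg (fun f : Module.End ℂ V => f x) this
      simp only [LinearMap.smul_apply, Module.End.one_apply] at h2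
      exact smul_left_injective ℂ hx (by simpa using h2)
    refine TensorProduct.ext' fun x f => ?_
    have e1 : ρ z x = c • x := by rw [hc]; rfl
    have e2 : ρ.dual z f = c' • f := by
      ext y
      rw [Representation.dual_apply, hc']
      simp [Module.Dual.transpose_apply]
    rw [hσ, Representation.tprod_apply, TensorProduct.map_tmul, e1, e2,
      TensorProduct.smul_tmul_smul, hcc, one_smul]
    rfl
  have h0 : (Nat.card G : ℂ) ≠ 0 := by exact_mod_cast Nat.card_pos.ne'
  let : Invertible (Nat.card G : ℂ) := invertibleOfNonzero h0
  have hf0 : Module.finrank ℂ σ.invariants = 1 := by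
    have := Representation.card_inv_mul_sum_char_eq_finrank (ρ := σ)
    simp only [hχ] at this
    rw [C.sum_cl, C.card, w0, w1, w2, w3, w4, w5, w6, w7] at this
    norm_num at this
    exact_mod_cast this.symm
  have s0 : IsSubrep σ σ.invariants := fun g x hx => by
    rw [hx g]; exact hx
  obtain ⟨W', s', hcm⟩ := exists_compl_subrep σ σ.invariants s0
  set η := restr σ W' s' with hη
  have hχ' : ∀ g, η.character g = wv v (ca (C.p g)) - 1 := by
    intro g
    rw [← hχ, char_add σ _ _ s0 s' hcm g]
    have : restr σ σ.invariants s0 g = 1 := by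
      ext x
      rw [restr_apply, x.2 g]; rfl
    have : (restr σ σ.invariants s0).character g = 1 := by
      unfold Representation.character
      rw [this, tr_one, hf0]; norm_num
    rw [this]; ring
  have hd1 : Module.finrank ℂ W' = 35 := by
    have := Submodule.finrank_add_eq_of_isCompl hcm
    rw [Module.finrank_tensorProduct, Subspace.dual_finrank_eq, hd, hf0] at this
    omega
  have hcard : (Finset.univ.filter fun g : G => ca (C.p g) = 2).card = 210 := by
    have := C.sum_cl (fun i => if i = 2 then 1 else 0)
    rw [Finset.sum_boole] at this
    have e : ((Finset.univ.filter fun g : G => ca (C.p g) = 2).card : ℂ) = (210 : ℕ) := by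
      rw [this]; simp [Fin.ext_iff]; norm_num
    exact_mod_cast e
  obtain ⟨A, B, hAB, iA, dA, iB, dB⟩ := two_dims η (by
      simp only [hχ', map_inv, ca_inv]
      rw [C.sum_cl (fun i => (wv v i - 1) * (wv v i - 1)), C.card, w0, w1, w2, w3, w4, w5, w6, w7]
      norm_num)
    (Finset.univ.filter fun g : G => ca (C.p g) = 2)
    (by
      intro g k hk
      simp only [Finset.mem_filter, Finset.mem_univ, true_and] at hk ⊢
      rw [map_mul, map_mul, map_inv, ca_mulconj, hk])
    (-1) 31500
    (by
      intro k hk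
      rw [hχ', (Finset.mem_filter.1 hk).2, w2]; norm_num)
    (by rw [← Finset.card_pos, hcard]; norm_num)
    (by
      have : ∀ k ∈ (Finset.univ.filter fun g : G => ca (C.p g) = 2),
          ∑ l ∈ (Finset.univ.filter fun g : G => ca (C.p g) = 2), η.character (k * l) = 150 := by
        intro k hk
        simp only [hχ', map_mul]
        rw [Finset.sum_filter]
        rw [C.sum_lift (fun t => if ca t = 2 then wv v (ca (C.p k * t)) - 1 else 0)]
        rw [← Finset.sum_filter]
        have := sum_pc2 (C.p k) (Finset.mem_filter.1 hk).2 (fun i => wv v i - 1)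
        rw [this, w0, w1, w2, w3, w5]
        norm_num
      rw [Finset.sum_congr rfl this, Finset.sum_const, hcard]
      norm_num)
    (by
      intro X hX hb hiX
      obtain ⟨x, hx⟩ := int3_restr C η (fun z hz => restr_one σ W' s' (hZ z hz)) X hX hb hiX
      exact ⟨x, fun k hk => hx k (Finset.mem_filter.1 hk).2⟩)
    14 21 (by
      rw [hd1, hcard]
      exact arith1)
  obtain ⟨z, hz, hz1⟩ := C.exists_z
  have hzt : ∀ W : Submodule ℂ (V ⊗[ℂ] Module.Dual ℂ V), ∃ g : G, g ≠ 1 ∧ ∀ x ∈ W, σ g x = x :=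
    fun W => ⟨z, hz1, fun x _ => by rw [hZ z hz]; rfl⟩
  have hsup : A.map W'.subtype ⊔ B.map W'.subtype = W' := by
    rw [← Submodule.map_sup, hAB.sup_eq_top, Submodule.map_top, Submodule.range_subtype]
  have hinf : Disjoint (A.map W'.subtype) (B.map W'.subtype) := by
    rw [disjoint_iff, ← Submodule.map_inf _ W'.subtype_injective, hAB.inf_eq_bot,
      Submodule.map_bot]
  refine ⟨σ.invariants, A.map W'.subtype, B.map W'.subtype, ?_, ?_, s0, hf0,
    fun g x hx => hx g, irred_push σ W' s' A iA, ?_, hzt _, irred_push σ W' s' B iB, ?_, hzt _⟩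
  · have hd0 : Disjoint σ.invariants (A.map W'.subtype ⊔ B.map W'.subtype) := by
      rw [hsup]; exact hcm.disjoint
    have d1 : Disjoint (σ.invariants ⊔ A.map W'.subtype) (B.map W'.subtype) :=
      Disjoint.disjoint_sup_left_of_disjoint_sup_right hinf hd0
    have d2 : Disjoint (A.map W'.subtype) (σ.invariants ⊔ B.map W'.subtype) := by
      have := Disjoint.disjoint_sup_left_of_disjoint_sup_right hinf.symm
        (by rwa [sup_comm] : Disjoint σ.invariants (B.map W'.subtype ⊔ A.map W'.subtype))
      exact this.symm
    intro i
    fin_cases i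
    · refine hd0.mono_right (iSup_le fun j => iSup_le fun hj => ?_)
      fin_cases j
      · exact absurd rfl hj
      · exact le_sup_left
      · exact le_sup_right
    · refine d2.mono_right (iSup_le fun j => iSup_le fun hj => ?_)
      fin_cases j
      · exact le_sup_left
      · exact absurd rfl hj
      · exact le_sup_right
    · refine d1.symm.mono_right (iSup_le fun j => iSup_le fun hj => ?_)
      fin_cases j
      · exact le_sup_left
      · exact le_sup_right
      · exact absurd rfl hj
  · rw [sup_assoc, hsup, hcm.sup_eq_top]
  · rw [← dA]
    exact (Submodule.equivMapOfInjective W'.subtype W'.subtype_injective A).finrank_eq.symm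
  · rw [← dB]
    exact (Submodule.equivMapOfInjective W'.subtype W'.subtype_injective B).finrank_eq.symm

end Main

end PartPH

section PartPI
section Main2
variable {G : Type} [Group G]

lemma Cov.sum_K (C : Cov G) (K : Finset G)
    (mK : ∀ k, k ∈ K ↔ k ^ 2 = 1 ∧ ca (C.p k) = 1) (f : alternatingGroup (Fin 7) → ℂ) :
    ∑ l ∈ K, f (C.p l) =
      ∑ t ∈ Finset.univ.filter (fun t => ca t = 1), f t := by
  refine Finset.sum_bij (fun k _ => C.p k) ?_ ?_ ?_ (fun _ _ => rfl)
  · intro k hk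
    rw [mK] at hk
    simp only [Finset.mem_filter, Finset.mem_univ, true_and]
    exact hk.2
  · intro a ha b hb h
    rw [mK] at ha hb
    exact C.cop_uniq (by norm_num : Nat.Coprime 2 3) h ha.1 hb.1
  · intro t ht
    simp only [Finset.mem_filter, Finset.mem_univ, true_and] at ht
    obtain ⟨y, h1, h2⟩ := C.real_lift t (by rw [ht]; decide)
    refine ⟨y, ?_, h1⟩
    rw [mK]
    refine ⟨C.real_pow h2 ?_, by rw [h1, ht]⟩
    have := pow_eo (C.p y)
    rw [h1, ht] at this
    rw [h1]; exact this

lemma faithful_of (C : Cov G) {M : Type} [AddCommGroup M] [Module ℂ M]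
    (σ : Representation ℂ G M) (W : Submodule ℂ M) (h : IsIrredSubrep σ W)
    (hz : ∀ z ∈ Subgroup.center G, z ≠ 1 → ∃ c : ℂ, c ≠ 1 ∧ σ z = c • 1) :
    FaithfulOn σ W := by
  obtain ⟨hs, hb, -⟩ := h
  have key : ∀ z ∈ Subgroup.center G, (∀ x ∈ W, σ z x = x) → z = 1 := by
    intro z hzc hx
    by_contra hne
    obtain ⟨c, hc, e⟩ := hz z hzc hne
    obtain ⟨x, hxW, hx0⟩ := Submodule.exists_mem_ne_zero_of_ne_bot hb
    have h1 := hx x hxW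
    rw [e] at h1
    have h2 : (c - 1) • x = 0 := by
      rw [sub_smul, one_smul, sub_eq_zero]; exact h1
    rcases smul_eq_zero.1 h2 with h3 | h3
    · exact hc (sub_eq_zero.1 h3)
    · exact hx0 h3
  have hmem : ∀ g, g ∈ (restr σ W hs).ker ↔ ∀ x ∈ W, σ g x = x := by
    intro g
    rw [MonoidHom.mem_ker]
    constructor
    · intro h x hx
      have := congrArg (fun f : Module.End ℂ W => ((f ⟨x, hx⟩ : W) : M)) h
      exact this
    · intro h
      ext x
      rw [restr_apply, h x x.2]; rfl
  intro g hg
  rcases C.normal (restr σ W hs).ker with h | h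
  · exact key g (h ((hmem g).2 hg)) hg
  · exfalso
    obtain ⟨z, hzc, hz1⟩ := C.exists_z
    exact hz1 (key z hzc ((hmem z).1 (h ▸ Subgroup.mem_top z)))

lemma center_triv [Finite G] (C : Cov G) {U : Type} [AddCommGroup U] [Module ℂ U]
    (τ : Representation ℂ G U)
    (hn : ¬ Function.Injective τ) : ∀ z ∈ Subgroup.center G, τ z = 1 := by
  have hne : τ.ker ≠ ⊥ := fun h => hn ((MonoidHom.ker_eq_bot_iff τ).1 h)
  rcases C.normal τ.ker with h | h
  · have hcard : τ.ker = Subgroup.center G := by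
      have hdvd := Subgroup.card_dvd_of_le h
      rw [C.cz, Nat.dvd_prime Nat.prime_three] at hdvd
      rcases hdvd with h1 | h1
      · exact absurd (Subgroup.card_eq_one.1 h1) hne
      · exact Subgroup.eq_of_le_of_card_ge h (by rw [C.cz, h1])
    intro z hz
    rw [← hcard] at hz
    exact hz
  · intro z _
    have : z ∈ τ.ker := h ▸ Subgroup.mem_top z
    exact this

lemma part2 [Fintype G] {V : Type} [AddCommGroup V] [Module ℂ V] [FiniteDimensional ℂ V]
    [Nontrivial V] (C : Cov G) (ρ : Representation ℂ G V)
    (hinj : Function.Injective ρ) (hd : Module.finrank ℂ V = 6) (hi : Irr ρ)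
    {U : Type} [AddCommGroup U] [Module ℂ U] (τ : Representation ℂ G U)
    (hdU : Module.finrank ℂ U = 6) (hiU : Irr τ) (hn : ¬ Function.Injective τ) :
    ∃ W₁ W₂ : Submodule ℂ (V ⊗[ℂ] U),
        W₁ ⊓ W₂ = ⊥ ∧ W₁ ⊔ W₂ = ⊤ ∧
        IsIrredSubrep (ρ.tprod τ) W₁ ∧ Module.finrank ℂ W₁ = 15 ∧
          FaithfulOn (ρ.tprod τ) W₁ ∧
        IsIrredSubrep (ρ.tprod τ) W₂ ∧ Module.finrank ℂ W₂ = 21 ∧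
          FaithfulOn (ρ.tprod τ) W₂ := by
  classical
  have fU : FiniteDimensional ℂ U := FiniteDimensional.of_finrank_pos (by rw [hdU]; norm_num)
  have nU : Nontrivial U := Module.nontrivial_of_finrank_pos (R := ℂ) (by rw [hdU]; norm_num)
  have hZ := center_triv C τ hn
  obtain ⟨v, D, v2, v6⟩ := dataV C ρ hi hd hinj
  obtain ⟨u, E, u2, u6, hu⟩ := dataU C τ hiU hdU hZ
  set σ : Representation ℂ G (V ⊗[ℂ] U) := ρ.tprod τ with hσ
  have hχ : ∀ g, σ.character g = ρ.character g * τ.character g := by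
    intro g
    rw [hσ, Representation.char_tensor, Pi.mul_apply]
  have hnorm : ∀ g, σ.character g * σ.character g⁻¹ = wv v (ca (C.p g)) * wv u (ca (C.p g)) := by
    intro g
    rw [← D.ph, ← E.ph, hχ, hχ]; ring
  have v1 : v 1 ^ 2 = 4 := by rcases D.v1 with h | h <;> rw [h] <;> norm_num
  have u1 : u 1 ^ 2 = 4 := by rcases E.v1 with h | h <;> rw [h] <;> norm_num
  have wn : ∀ (w : Fin 8 → ℂ) (i : Fin 8), i ≠ 7 → wv w i = w i ^ 2 := fun w i hi => by
    rw [wv, if_neg hi]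
  have w7 : ∀ (w : Fin 8 → ℂ), wv w 7 = 1 := fun w => by rw [wv, if_pos rfl]
  have hs : ∃ s : ℤ, (s = 4 ∨ s = -4) ∧ v 1 * u 1 = s := by
    rcases D.v1 with h | h <;> rcases E.v1 with h' | h' <;> rw [h, h']
    · exact ⟨4, Or.inl rfl, by norm_num⟩
    · exact ⟨-4, Or.inr rfl, by norm_num⟩
    · exact ⟨-4, Or.inr rfl, by norm_num⟩
    · exact ⟨4, Or.inl rfl, by norm_num⟩
  obtain ⟨s, hs, hvu⟩ := hs
  have hre : ∀ y, Rl y → ca (C.p y) ≠ 7 →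
      σ.character y = v (ca (C.p y)) * u (ca (C.p y)) := by
    intro y hy h7
    rw [hχ, D.re y hy h7, E.re y hy h7]
  set K := Finset.univ.filter (fun k : G => k ^ 2 = 1 ∧ ca (C.p k) = 1) with hK
  have mK : ∀ k, k ∈ K ↔ k ^ 2 = 1 ∧ ca (C.p k) = 1 := fun k => by
    rw [hK, Finset.mem_filter]; simp
  have hcard : K.card = 105 := by
    have := C.sum_K K mK (fun _ => 1)
    rw [Finset.sum_const, Finset.sum_const, card_ca] at this
    have e : (K.card : ℂ) = (105 : ℕ) := by
      simpa [cn] using this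
    exact_mod_cast e
  obtain ⟨A, B, hAB, iA, dA, iB, dB⟩ := two_dims σ (by
      simp only [hnorm]
      rw [C.sum_cl (fun i => wv v i * wv u i), C.card, w7, w7, wn v 0 (by decide),
        wn v 1 (by decide), wn v 2 (by decide), wn v 3 (by decide), wn v 4 (by decide),
        wn v 5 (by decide), wn v 6 (by decide), wn u 0 (by decide),
        wn u 1 (by decide), wn u 2 (by decide), wn u 3 (by decide), wn u 4 (by decide),
        wn u 5 (by decide), wn u 6 (by decide), D.v0, E.v0, v2, u2, D.v3, D.v4, D.v5, E.v5,
        v6, u6, div_pow, neg_sq, v1, u1]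
      norm_num)
    K
    (by
      intro g k hk
      rw [mK] at hk ⊢
      refine ⟨?_, by rw [map_mul, map_mul, map_inv, ca_mulconj, hk.2]⟩
      rw [conj_pow, hk.1]; group)
    s (105 * (60 + 2 * s))
    (by
      intro k hk
      rw [mK] at hk
      rw [hre k (rl_of_sq hk.1) (by rw [hk.2]; decide), hk.2, hvu])
    (by rw [← Finset.card_pos, hcard]; norm_num)
    (by
      have : ∀ k ∈ K, ∑ l ∈ K, σ.character (k * l) = 60 + 2 * s := by
        intro k hk
        have hk' := (mK k).1 hk
        have e : ∀ l ∈ K, σ.character (k * l) =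
            (fun t => v (ca (C.p k * t)) * u (ca (C.p k * t))) (C.p l) := by
          intro l hl
          have hl' := (mK l).1 hl
          have := hre (k * l) ⟨k, by
            rw [mul_inv_rev, inv_eq_of_mul_eq_one_right (show k * k = 1 by rw [← sq, hk'.1]),
              inv_eq_of_mul_eq_one_right (show l * l = 1 by rw [← sq, hl'.1]),
              ← mul_assoc k k l, ← sq, hk'.1, one_mul]⟩
            (by rw [map_mul]; exact no_seven _ _ hk'.2 hl'.2)
          rw [this, map_mul]
        rw [Finset.sum_congr rfl e,
          C.sum_K K mK (fun t => v (ca (C.p k * t)) * u (ca (C.p k * t)))]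
        have := sum_pc1 (C.p k) hk'.2 (fun i => v i * u i)
        rw [this, D.v0, E.v0, v2, D.v3, D.v4, D.v5, E.v5, v6, u6]
        linear_combination 2 * hvu
      rw [Finset.sum_congr rfl this, Finset.sum_const, hcard]
      push_cast
      ring)
    (by
      intro X hX hb hiX
      have n1 : Nontrivial X := Submodule.nontrivial_iff_ne_bot.2 hb
      obtain ⟨x, hx⟩ := int2 C (restr σ X hX) hiX
      exact ⟨x, fun k hk => hx k ((mK k).1 hk).1 ((mK k).1 hk).2⟩)
    15 21 (by
      rw [hcard, Module.finrank_tensorProduct, hd, hdU]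
      exact arith2 s hs)
  have hf : ∀ z ∈ Subgroup.center G, z ≠ 1 → ∃ c : ℂ, c ≠ 1 ∧ σ z = c • 1 := by
    intro z hz hz1
    obtain ⟨c, hc⟩ := central_scalar ρ hi hz
    refine ⟨c, ?_, ?_⟩
    · rintro rfl
      rw [one_smul, ← map_one ρ] at hc
      exact hz1 (hinj hc)
    · rw [hσ, Representation.tprod_apply, hc, hZ z hz]
      refine TensorProduct.ext' fun x y => ?_
      rw [TensorProduct.map_tmul]
      rfl
  exact ⟨A, B, hAB.inf_eq_bot, hAB.sup_eq_top, iA, dA, faithful_of C σ A iA hf, iB, dB,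
    faithful_of C σ B iB hf⟩

end Main2

end PartPI

/-- Let `V′` be a faithful irreducible six-dimensional complex representation of `3.A₇` and
`V″ = (V′)∨` its dual.  Then `V′ ⊗ V″` is the direct sum of the trivial representation and two
irreducible non-faithful representations (factoring through `A₇`) of dimensions `14` and `21`.
If instead `V″` is the non-faithful irreducible six-dimensional representation of `3.A₇`, then
`V′ ⊗ V″` is the direct sum of two faithful irreducible representations of dimensions `15`
and `21`. -/
theorem tensor_decompositions_of_six_dim_faithful_3A7
    (G : Type) [Group G] [Finite G] (hG : IsTripleCoverA7 G)
    (V : Type) [AddCommGroup V] [Module ℂ V] [FiniteDimensional ℂ V]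
    (ρ : Representation ℂ G V)
    (hfaithful : Function.Injective ρ)
    (hdim : Module.finrank ℂ V = 6)
    (hirr : ∀ W : Submodule ℂ V, (∀ g : G, ∀ v ∈ W, ρ g v ∈ W) → W = ⊥ ∨ W = ⊤) :
    (∃ W₀ W₁ W₂ : Submodule ℂ (V ⊗[ℂ] Module.Dual ℂ V),
      iSupIndep ![W₀, W₁, W₂] ∧ W₀ ⊔ W₁ ⊔ W₂ = ⊤ ∧
      IsSubrep (ρ.tprod ρ.dual) W₀ ∧ Module.finrank ℂ W₀ = 1 ∧
        TrivialOn (ρ.tprod ρ.dual) W₀ ∧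
      IsIrredSubrep (ρ.tprod ρ.dual) W₁ ∧ Module.finrank ℂ W₁ = 14 ∧
        (∃ g : G, g ≠ 1 ∧ ∀ x ∈ W₁, (ρ.tprod ρ.dual) g x = x) ∧
      IsIrredSubrep (ρ.tprod ρ.dual) W₂ ∧ Module.finrank ℂ W₂ = 21 ∧
        (∃ g : G, g ≠ 1 ∧ ∀ x ∈ W₂, (ρ.tprod ρ.dual) g x = x)) ∧
    (∀ (U : Type) (_ : AddCommGroup U) (_ : Module ℂ U) (τ : Representation ℂ G U),
      Module.finrank ℂ U = 6 →
      (∀ W : Submodule ℂ U, (∀ g : G, ∀ v ∈ W, τ g v ∈ W) → W = ⊥ ∨ W = ⊤) →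
      ¬ Function.Injective τ →
      ∃ W₁ W₂ : Submodule ℂ (V ⊗[ℂ] U),
        W₁ ⊓ W₂ = ⊥ ∧ W₁ ⊔ W₂ = ⊤ ∧
        IsIrredSubrep (ρ.tprod τ) W₁ ∧ Module.finrank ℂ W₁ = 15 ∧
          FaithfulOn (ρ.tprod τ) W₁ ∧
        IsIrredSubrep (ρ.tprod τ) W₂ ∧ Module.finrank ℂ W₂ = 21 ∧
          FaithfulOn (ρ.tprod τ) W₂) := by
  classical
  have : Fintype G := Fintype.ofFinite G
  have : Nontrivial V := Module.nontrivial_of_finrank_pos (R := ℂ) (by rw [hdim]; norm_num)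
  obtain ⟨C⟩ := cov_of G hG
  refine ⟨part1 C ρ hfaithful hdim hirr, ?_⟩
  intro U _ _ τ hdU hiU hn
  exact part2 C ρ hfaithful hdim hirr τ hdU hiU hn
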